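/- Let c_j be the first surely-nonequivalent configuration pair in the run ρ_min of a minimal witness, with counter values (m_{c_j}, n_{c_j}). Then max{m_{c_j}, n_{c_j}} ≤ P₁(K) + K·(K²·P₂(K)) + 1, where P₁(K) = 14K⁶ and P₂(K) = 6K⁴. -/

import Mathlib

/-- A deterministic weighted real-time one-counter automaton (dwROCA) over
alphabet `A` and field `S`.  `next q b a`, `upd q b a`, `wt q b a` give the
target state, counter update and (nonzero) weight of the unique transition
from state `q` reading letter `a` with counter-status `b` (`true` = counter is
zero). -/
structure DWROCA (A : Type) (S : Type) [Field S] where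
  Q : Type
  fin : Fintype Q
  q0 : Q
  s0 : S
  s0_ne : s0 ≠ 0
  next : Q → Bool → A → Q
  upd : Q → Bool → A → ℤ
  wt : Q → Bool → A → S
  upd_mem : ∀ q b a, upd q b a ∈ ({-1, 0, 1} : Set ℤ)
  no_dec_on_zero : ∀ q a, upd q true a ≠ -1
  wt_ne : ∀ q b a, wt q b a ≠ 0

attribute [instance] DWROCA.fin

/-- Configurations: a state, a counter value and a weight. -/
abbrev DWROCA.Cfg {A S : Type} [Field S] (M : DWROCA A S) : Type := M.Q × ℕ × S

variable {A S : Type} [Field S]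

/-- One step of a dwROCA on a configuration. -/
def DWROCA.step (M : DWROCA A S) (c : M.Cfg) (x : A) : M.Cfg :=
  (M.next c.1 (decide (c.2.1 = 0)) x,
   ((c.2.1 : ℤ) + M.upd c.1 (decide (c.2.1 = 0)) x).toNat,
   c.2.2 * M.wt c.1 (decide (c.2.1 = 0)) x)

/-- The run of a dwROCA on a word from a configuration. -/
def DWROCA.run (M : DWROCA A S) (c : M.Cfg) (w : List A) : M.Cfg :=
  w.foldl M.step c

/-- `f(w, c)`: the value assigned to the word `w` by the configuration `c`. -/
def DWROCA.val (M : DWROCA A S) (c : M.Cfg) (w : List A) : S :=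
  (M.run c w).2.2

/-- The initial configuration. -/
def DWROCA.init (M : DWROCA A S) : M.Cfg := (M.q0, 0, M.s0)

/-- The function `f_A : Σ* → S` computed by a dwROCA. -/
def DWROCA.f (M : DWROCA A S) (w : List A) : S := M.val M.init w

/-- One step of the underlying uninitialised weighted automaton `uwa(M)`:
the counter is ignored (nonzero tests are always taken).  Its configurations
are pairs (state, weight). -/
def DWROCA.ustep (M : DWROCA A S) (c : M.Q × S) (x : A) : M.Q × S :=
  (M.next c.1 false x, c.2 * M.wt c.1 false x)

/-- The value assigned to a word by a configuration of `uwa(M)`. -/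
def DWROCA.uval (M : DWROCA A S) (c : M.Q × S) (w : List A) : S :=
  (w.foldl M.ustep c).2

/-- `k`-equivalence of configurations of two dwROCAs. -/
def kEquiv (M N : DWROCA A S) (c : M.Cfg) (d : N.Cfg) (k : ℕ) : Prop :=
  ∀ w : List A, w.length ≤ k → M.val c w = N.val d w

/-- `k`-equivalence of a configuration of `M` with a configuration of the
underlying weighted automaton `uwa(N)`. -/
def kEquivU (M N : DWROCA A S) (c : M.Cfg) (d : N.Q × S) (k : ℕ) : Prop :=
  ∀ w : List A, w.length ≤ k → M.val c w = N.uval d w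

/-- Membership in `NWA` (relative to the pair `A₁`, `A₂`): a configuration of
`M` (where `M` is `A₁` or `A₂`) not `K`-equivalent to any configuration of
`uwa(A₁) ∪ uwa(A₂)`. -/
def inNWA (A₁ A₂ M : DWROCA A S) (c : M.Cfg) (K : ℕ) : Prop :=
  (∀ d : A₁.Q × S, ¬ kEquivU M A₁ c d K) ∧ (∀ d : A₂.Q × S, ¬ kEquivU M A₂ c d K)

/-- `dist(c)`: least length of a word taking `c` into `NWA` (`⊤` if none). -/
noncomputable def distNWA (A₁ A₂ M : DWROCA A S) (c : M.Cfg) (K : ℕ) : ℕ∞ :=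
  sInf {n : ℕ∞ | ∃ w : List A, (w.length : ℕ∞) = n ∧ inNWA A₁ A₂ M (M.run c w) K}

/-- A configuration pair is surely-equivalent if the two configurations are
`K`-equivalent and both have infinite distance to `NWA`. -/
def surelyEq (A₁ A₂ : DWROCA A S) (c : A₁.Cfg) (d : A₂.Cfg) (K : ℕ) : Prop :=
  kEquiv A₁ A₂ c d K ∧ distNWA A₁ A₂ A₁ c K = ⊤ ∧ distNWA A₁ A₂ A₂ d K = ⊤

/-- A configuration pair is surely-nonequivalent if the two configurations are
not `K`-equivalent or have different distances to `NWA`. -/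
def surelyNonEq (A₁ A₂ : DWROCA A S) (c : A₁.Cfg) (d : A₂.Cfg) (K : ℕ) : Prop :=
  ¬ kEquiv A₁ A₂ c d K ∨ distNWA A₁ A₂ A₁ c K ≠ distNWA A₁ A₂ A₂ d K

/-- A configuration pair is unresolved if the configurations are `K`-equivalent
and have equal finite distances to `NWA`. -/
def unresolved (A₁ A₂ : DWROCA A S) (c : A₁.Cfg) (d : A₂.Cfg) (K : ℕ) : Prop :=
  kEquiv A₁ A₂ c d K ∧ distNWA A₁ A₂ A₁ c K = distNWA A₁ A₂ A₂ d K ∧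
    distNWA A₁ A₂ A₁ c K ≠ ⊤

/-- `w` is a minimal-length witness distinguishing `A₁` and `A₂`. -/
def IsMinWitness (A₁ A₂ : DWROCA A S) (w : List A) : Prop :=
  A₁.f w ≠ A₂.f w ∧ ∀ v : List A, A₁.f v ≠ A₂.f v → w.length ≤ v.length

/-- The `i`-th configuration pair `c_i` of the run of `w` from the initial
configuration pair. -/
def pairAt (A₁ A₂ : DWROCA A S) (w : List A) (i : ℕ) : A₁.Cfg × A₂.Cfg :=
  (A₁.run A₁.init (w.take i), A₂.run A₂.init (w.take i))

/-- Applying a sequence of transition pairs (determined, by determinism, by a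
word) to a configuration pair. -/
def runPair (A₁ A₂ : DWROCA A S) (c : A₁.Cfg × A₂.Cfg) (w : List A) :
    A₁.Cfg × A₂.Cfg :=
  (A₁.run c.1 w, A₂.run c.2 w)

/-- A configuration pair lies in the belt of slope `α/β` and thickness `d`. -/
def inBelt (α β d : ℕ) {A₁ A₂ : DWROCA A S} (c : A₁.Cfg × A₂.Cfg) : Prop :=
  |(α : ℤ) * (c.1.2.1 : ℤ) - (β : ℤ) * (c.2.2.1 : ℤ)| ≤ (d : ℤ)

/-- Two configuration pairs are `(α/β)`-related: same state pairs and same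
value of `α·m - β·n`. -/
def abRelated (α β : ℕ) {A₁ A₂ : DWROCA A S} (c c' : A₁.Cfg × A₂.Cfg) : Prop :=
  c.1.1 = c'.1.1 ∧ c.2.1 = c'.2.1 ∧
    (α : ℤ) * (c.1.2.1 : ℤ) - (β : ℤ) * (c.2.2.1 : ℤ) =
      (α : ℤ) * (c'.1.2.1 : ℤ) - (β : ℤ) * (c'.2.2.1 : ℤ)

namespace CounterWalk

section Walk

variable {Q A : Type} (nx : Q → A → Q) (f : Q → A → ℤ)

/-- The state reached from `q` by reading `w`. -/
def state (q : Q) (w : List A) : Q := w.foldl nx q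

/-- The total counter effect of reading `w` from `q`. -/
def effect : Q → List A → ℤ
  | _, [] => 0
  | q, a :: w => f q a + effect (nx q a) w

/-- The `k`-fold repetition of a word. -/
def rep (c : List A) (k : ℕ) : List A := (List.replicate k c).flatten

@[simp] lemma rep_zero (c : List A) : rep c 0 = [] := rfl

lemma rep_succ (c : List A) (k : ℕ) : rep c (k + 1) = c ++ rep c k := by
  simp [rep, List.replicate_succ]

lemma rep_add (c : List A) (k l : ℕ) : rep c (k + l) = rep c k ++ rep c l := by
  rw [rep, List.replicate_add, List.flatten_append, rep, rep]

lemma rep_mul (c : List A) (k l : ℕ) : rep c (k * l) = rep (rep c k) l := by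
  induction l with
  | zero => simp
  | succ l ih => rw [Nat.mul_succ, Nat.add_comm, rep_add, ih, rep_succ]

@[simp] lemma length_rep (c : List A) (k : ℕ) : (rep c k).length = k * c.length := by
  simp [rep]

@[simp] lemma state_nil (q : Q) : state nx q [] = q := rfl

@[simp] lemma state_cons (q : Q) (a : A) (w : List A) :
    state nx q (a :: w) = state nx (nx q a) w := rfl

lemma state_append (q : Q) (v w : List A) :
    state nx q (v ++ w) = state nx (state nx q v) w := by
  simp [state]

@[simp] lemma effect_nil (q : Q) : effect nx f q [] = 0 := rfl

@[simp] lemma effect_cons (q : Q) (a : A) (w : List A) :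
    effect nx f q (a :: w) = f q a + effect nx f (nx q a) w := rfl

lemma effect_append (q : Q) (v w : List A) :
    effect nx f q (v ++ w) = effect nx f q v + effect nx f (state nx q v) w := by
  induction v generalizing q with
  | nil => simp
  | cons a v ih => simp [ih, add_assoc]

variable {f} in
lemma abs_effect_le (hf : ∀ q a, |f q a| ≤ 1) (q : Q) (w : List A) :
    |effect nx f q w| ≤ w.length := by
  induction w generalizing q with
  | nil => simp
  | cons a w ih =>
    have h1 := hf q a
    have h2 := ih (nx q a)
    have h3 := abs_add_le (f q a) (effect nx f (nx q a) w)
    simp only [effect_cons, List.length_cons]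
    push_cast
    linarith

variable {nx} in
lemma state_rep {q : Q} {c : List A} (hc : state nx q c = q) (k : ℕ) :
    state nx q (rep c k) = q := by
  induction k with
  | zero => rfl
  | succ k ih => rw [rep_succ, state_append, hc, ih]

variable {nx} in
lemma effect_rep {q : Q} {c : List A} (hc : state nx q c = q) (k : ℕ) :
    effect nx f q (rep c k) = k * effect nx f q c := by
  induction k with
  | zero => simp
  | succ k ih =>
    rw [rep_succ, effect_append, hc, ih]
    push_cast
    ring

/-- The state `r` is visited while reading `w` from `p`. -/
def Visits (p : Q) (w : List A) (r : Q) : Prop := ∃ v, v <+: w ∧ state nx p v = r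

lemma visits_iff (p : Q) (w : List A) (r : Q) :
    Visits nx p w r ↔ ∃ v₁ v₂, w = v₁ ++ v₂ ∧ state nx p v₁ = r := by
  constructor
  · rintro ⟨v, ⟨t, rfl⟩, h⟩
    exact ⟨v, t, rfl, h⟩
  · rintro ⟨v₁, v₂, rfl, h⟩
    exact ⟨v₁, List.prefix_append _ _, h⟩

/-- A long walk contains a short cycle whose removal does not lose any visited state. -/
lemma exists_removable_cycle [Fintype Q] (p : Q) (s : List A)
    (hs : Fintype.card Q * Fintype.card Q ≤ s.length) :
    ∃ s₁ c s₂, s = s₁ ++ (c ++ s₂) ∧ c ≠ [] ∧ c.length ≤ Fintype.card Q ∧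
      state nx (state nx p s₁) c = state nx p s₁ ∧
      ∀ r, Visits nx p s r → Visits nx p (s₁ ++ s₂) r := by
  classical
  set n := Fintype.card Q with hn
  have hn0 : 0 < n := Fintype.card_pos_iff.mpr ⟨p⟩
  set g : ℕ → Q := fun i => state nx p (s.take i) with hg
  -- a block of `n` positions containing no first visit
  have hblock : ∃ b < n, ∀ i, b * n < i → i ≤ b * n + n → ∃ i' < i, g i' = g i := by
    by_contra hcon
    push Not at hcon
    choose! φ h1 h2 h3 using hcon
    have hinj : Function.Injective (fun b : Fin n => g (φ b)) := by
      intro b b' hbb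
      have hφ : φ b = φ b' := by
        rcases lt_trichotomy (φ b) (φ b') with h | h | h
        · exact absurd hbb (h3 b' b'.2 _ h)
        · exact h
        · exact absurd hbb.symm (h3 b b.2 _ h)
      have e1 := h1 b b.2
      have e2 := h2 b b.2
      have e3 := h1 b' b'.2
      have e4 := h2 b' b'.2
      rw [hφ] at e1 e2
      ext
      have k1 : (b : ℕ) < b' + 1 := by
        by_contra hk
        have : ((b' : ℕ) + 1) * n ≤ b * n := Nat.mul_le_mul_right _ (by omega)
        rw [Nat.add_mul] at this
        omega
      have k2 : (b' : ℕ) < b + 1 := by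
        by_contra hk
        have : ((b : ℕ) + 1) * n ≤ b' * n := Nat.mul_le_mul_right _ (by omega)
        rw [Nat.add_mul] at this
        omega
      omega
    have hbij : Function.Bijective (fun b : Fin n => g (φ b)) :=
      (Fintype.bijective_iff_injective_and_card _).2 ⟨hinj, by simp [hn]⟩
    obtain ⟨b, hb⟩ := hbij.2 (g 0)
    have := h1 b b.2
    exact h3 b b.2 0 (by omega) hb.symm
  obtain ⟨b, hb, hfirst⟩ := hblock
  have hbn : b * n + n ≤ s.length := by
    have : (b + 1) * n ≤ n * n := Nat.mul_le_mul_right _ hb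
    rw [Nat.add_mul] at this
    omega
  obtain ⟨i, i', hne, hii⟩ := Fintype.exists_ne_map_eq_of_card_lt
    (fun i : Fin (n + 1) => g (b * n + i)) (by simp [← hn])
  wlog hlt : i < i' generalizing i i'
  · exact this i' i hne.symm hii.symm (lt_of_le_of_ne (not_lt.1 hlt) hne.symm)
  have hlt' : (i : ℕ) < i' := hlt
  have hi' := i'.2
  set x := b * n + i
  set y := b * n + i'
  have hxy : x < y := by omega
  have hys : y ≤ s.length := by omega
  have hsplit : s.take y = s.take x ++ (s.drop x).take (y - x) := by
    rw [← List.take_add]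
    congr 1
    omega
  have hsplit' : s = s.take x ++ ((s.drop x).take (y - x) ++ s.drop y) := by
    rw [← List.append_assoc, ← hsplit, List.take_append_drop]
  have hcyc : state nx (state nx p (s.take x)) ((s.drop x).take (y - x)) =
      state nx p (s.take x) := by
    rw [← state_append, ← hsplit]
    exact hii.symm
  refine ⟨s.take x, (s.drop x).take (y - x), s.drop y, hsplit', ?_, ?_, hcyc, ?_⟩
  · intro h
    have := congrArg List.length h
    simp at this
    omega
  · simp
    omega
  · -- the positions up to `x` and from `y` on survive
    have hsurv : ∀ t ≤ s.length, (t ≤ x ∨ y ≤ t) →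
        Visits nx p (s.take x ++ s.drop y) (g t) := by
      intro t ht hxt
      rw [visits_iff]
      rcases hxt with h | h
      · refine ⟨s.take t, (s.take x).drop t ++ s.drop y, ?_, rfl⟩
        rw [← List.append_assoc]
        congr 1
        conv_lhs => rw [← List.take_append_drop t (s.take x)]
        rw [List.take_take, min_eq_left h]
      · refine ⟨s.take x ++ (s.drop y).take (t - y), (s.drop y).drop (t - y), ?_, ?_⟩
        · rw [List.append_assoc, List.take_append_drop]
        · have hxy' : state nx p (s.take y) = state nx p (s.take x) := hii.symm
          rw [state_append, ← hxy', ← state_append, ← List.take_add]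
          simp only [hg]
          congr 2
          omega
    rintro r ⟨v, hv, rfl⟩
    have hvt : v = s.take v.length := (List.prefix_iff_eq_take.1 hv)
    have hvl := hv.length_le
    have key : ∀ t ≤ s.length, Visits nx p (s.take x ++ s.drop y) (g t) := by
      intro t
      induction t using Nat.strong_induction_on with
      | _ t ih =>
        intro ht
        by_cases h : t ≤ x ∨ y ≤ t
        · exact hsurv t ht h
        · push Not at h
          obtain ⟨t', ht', e⟩ := hfirst t (by omega) (by omega)
          rw [← e]
          exact ih t' ht' (by omega)
    have := key v.length hvl
    simp only [hg] at this
    rwa [← hvt] at this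

variable {nx f} in
/-- A walk splits into a short walk and short cycles attached to it. -/
lemma exists_skeleton [Fintype Q] (p : Q) (v : List A) :
    ∃ (s : List A) (C : List (Q × List A)),
      s.length < Fintype.card Q * Fintype.card Q ∧
      state nx p s = state nx p v ∧
      s.length + (C.map fun c => c.2.length).sum = v.length ∧
      effect nx f p s + (C.map fun c => effect nx f c.1 c.2).sum = effect nx f p v ∧
      (∀ r, Visits nx p v r → Visits nx p s r) ∧
      ∀ c ∈ C, state nx c.1 c.2 = c.1 ∧ c.2 ≠ [] ∧ c.2.length ≤ Fintype.card Q ∧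
        Visits nx p s c.1 := by
  induction hN : v.length using Nat.strong_induction_on generalizing v with
  | _ N ih =>
    by_cases hv : v.length < Fintype.card Q * Fintype.card Q
    · exact ⟨v, [], hv, rfl, by simp [hN], by simp, fun _ h => h, by simp⟩
    · obtain ⟨s₁, c, s₂, rfl, hc0, hcl, hcyc, hvis⟩ :=
        exists_removable_cycle nx p v (not_lt.1 hv)
      have hpos : 0 < c.length := List.length_pos_iff.2 hc0
      simp only [List.length_append] at hN
      obtain ⟨s, C, h1, h2, h3, h4, h5, h6⟩ :=
        ih (s₁ ++ s₂).length (by simp; omega) (s₁ ++ s₂) rfl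
      refine ⟨s, (state nx p s₁, c) :: C, h1, ?_, ?_, ?_, fun r hr => h5 r (hvis r hr), ?_⟩
      · rw [h2, state_append, state_append, state_append, hcyc]
      · simp only [List.length_append] at h3
        simp only [List.map_cons, List.sum_cons]
        omega
      · simp only [effect_append] at h4
        simp only [List.map_cons, List.sum_cons, effect_append, hcyc]
        linarith
      · intro d hd
        rcases List.mem_cons.1 hd with rfl | hd
        · refine ⟨hcyc, hc0, hcl, h5 _ (hvis _ ?_)⟩
          exact ⟨s₁, List.prefix_append _ _, rfl⟩
        · exact h6 d hd

variable {nx f} in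
/-- Cycles attached to a walk can be inserted into it. -/
lemma exists_insert_cycles (p : Q) (s : List A) (C : List (Q × List A))
    (hC : ∀ c ∈ C, state nx c.1 c.2 = c.1 ∧ Visits nx p s c.1) :
    ∃ v, state nx p v = state nx p s ∧
      v.length = s.length + (C.map fun c => c.2.length).sum ∧
      effect nx f p v = effect nx f p s + (C.map fun c => effect nx f c.1 c.2).sum ∧
      ∀ r, Visits nx p s r → Visits nx p v r := by
  induction C with
  | nil => exact ⟨s, rfl, by simp, by simp, fun _ h => h⟩
  | cons c C ih =>
    obtain ⟨v, h1, h2, h3, h4⟩ := ih fun d hd => hC d (List.mem_cons_of_mem _ hd)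
    obtain ⟨hcyc, hvis⟩ := hC c List.mem_cons_self
    obtain ⟨v₁, v₂, rfl, hr⟩ := (visits_iff nx p v c.1).1 (h4 _ hvis)
    refine ⟨v₁ ++ (c.2 ++ v₂), ?_, ?_, ?_, ?_⟩
    · rw [← h1]
      simp only [state_append, hr, hcyc]
    · simp only [List.length_append, List.map_cons, List.sum_cons] at h2 ⊢
      omega
    · simp only [effect_append, List.map_cons, List.sum_cons, hr, hcyc] at h3 ⊢
      linarith
    · intro r hvr
      obtain ⟨u₁, u₂, hu, hur⟩ := (visits_iff nx p _ r).1 (h4 r hvr)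
      rw [visits_iff]
      rcases List.append_eq_append_iff.1 hu with ⟨t, rfl, rfl⟩ | ⟨t, rfl, rfl⟩
      · refine ⟨v₁ ++ (c.2 ++ t), u₂, by simp, ?_⟩
        rw [← hur]
        simp only [state_append, hr, hcyc]
      · exact ⟨u₁, t ++ (c.2 ++ v₂), by simp, hur⟩

end Walk

/-- Every list of integers splits into fewer than `δ` terms and a rest with sum divisible
by `δ`. -/
lemma exists_perm_append_dvd_sum {ι : Type} (f : ι → ℤ) {δ : ℕ} (hδ : 0 < δ) (L : List ι) :
    ∃ L₁ L₂, L.Perm (L₁ ++ L₂) ∧ L₁.length < δ ∧ (δ : ℤ) ∣ (L₂.map f).sum := by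
  induction hN : L.length using Nat.strong_induction_on generalizing L with
  | _ N ih =>
    by_cases hL : L.length < δ
    · exact ⟨L, [], by simp, hL, by simp⟩
    · have : NeZero δ := ⟨hδ.ne'⟩
      obtain ⟨i, i', hne, hii⟩ := Fintype.exists_ne_map_eq_of_card_lt
        (fun i : Fin (δ + 1) => ((((L.take i).map f).sum : ℤ) : ZMod δ)) (by simp)
      wlog hlt : i < i' generalizing i i'
      · exact this i' i hne.symm hii.symm (lt_of_le_of_ne (not_lt.1 hlt) hne.symm)
      have hlt' : (i : ℕ) < i' := hlt
      have hi' := i'.2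
      have hsplit : L.take i' = L.take i ++ (L.drop i).take (i' - i) := by
        rw [← List.take_add]
        congr 1
        omega
      have hsplit' : L = L.take i ++ ((L.drop i).take (i' - i) ++ L.drop i') := by
        rw [← List.append_assoc, ← hsplit, List.take_append_drop]
      have hdvd : (δ : ℤ) ∣ (((L.drop i).take (i' - i)).map f).sum := by
        have h := hii
        simp only [hsplit, List.map_append, List.sum_append, Int.cast_add] at h
        exact (ZMod.intCast_zmod_eq_zero_iff_dvd _ _).1 (left_eq_add.1 h)
      obtain ⟨L₁, L₂, h1, h2, h3⟩ := ih (L.take i ++ L.drop i').length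
        (by simp; omega) _ rfl
      refine ⟨L₁, L₂ ++ (L.drop i).take (i' - i), ?_, h2, ?_⟩
      · have e1 : L.Perm ((L.take i ++ L.drop i') ++ (L.drop i).take (i' - i)) := by
          conv_lhs => rw [hsplit']
          rw [List.append_assoc]
          exact List.Perm.append_left _ List.perm_append_comm
        refine e1.trans ?_
        rw [← List.append_assoc]
        exact h1.append_right _
      · rw [List.map_append, List.sum_append]
        exact dvd_add h3 hdvd

/-- Normal form of a walk with a large drop: a short prefix and suffix, and in between the
iteration of one short cycle with positive drop. -/
theorem exists_normal_form {Q A : Type} [Fintype Q] {nx : Q → A → Q} {f : Q → A → ℤ}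
    (hf : ∀ q a, |f q a| ≤ 1) (p : Q) (v : List A)
    (hv : (2 * (Fintype.card Q) ^ 2 : ℤ) ≤ -effect nx f p v) :
    ∃ (pre γ post : List A) (k δ : ℕ),
      1 ≤ δ ∧ δ ≤ γ.length ∧ γ.length ≤ Fintype.card Q ∧
      state nx (state nx p pre) γ = state nx p pre ∧
      effect nx f (state nx p pre) γ = -δ ∧
      state nx (state nx p pre) post = state nx p v ∧
      effect nx f p pre - k * δ + effect nx f (state nx p pre) post = effect nx f p v ∧
      pre.length + k * γ.length + post.length ≤ v.length ∧
      pre.length + post.length ≤ 2 * (Fintype.card Q) ^ 2 := by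
  classical
  set n := Fintype.card Q with hn
  have hn0 : 0 < n := Fintype.card_pos_iff.mpr ⟨p⟩
  obtain ⟨s, C, hs, hst, hlen, heff, -, hC⟩ := exists_skeleton (nx := nx) (f := f) p v
  rw [← hn] at hs hC
  set e : Q × List A → ℤ := fun c => effect nx f c.1 c.2 with he
  set g : Q × List A → ℕ := fun c => c.2.length with hg
  have hse := abs_le.1 (abs_effect_le nx hf p s)
  have hCsum : (C.map e).sum < -(n * n : ℤ) := by
    have : (s.length : ℤ) < n * n := by exact_mod_cast hs
    nlinarith
  have hneg : ∃ c ∈ C, e c < 0 := by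
    by_contra hcon
    push Not at hcon
    have : 0 ≤ (C.map e).sum := List.sum_nonneg (by
      intro x hx
      obtain ⟨d, hd, rfl⟩ := List.mem_map.1 hx
      exact hcon d hd)
    nlinarith
  obtain ⟨c₀, hc₀, hc₀neg⟩ := hneg
  obtain ⟨c, hcC, hmin⟩ := C.toFinset.exists_min_image (fun c => (e c : ℚ) / (g c : ℚ))
    ⟨c₀, by simpa using hc₀⟩
  rw [List.mem_toFinset] at hcC
  have hgpos : ∀ d ∈ C, (0 : ℚ) < g d := fun d hd => by
    have := List.length_pos_iff.2 (hC d hd).2.1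
    exact_mod_cast this
  have hcneg : e c < 0 := by
    have h1 := hmin c₀ (by simpa using hc₀)
    have h2 : (e c₀ : ℚ) / (g c₀ : ℚ) < 0 :=
      div_neg_of_neg_of_pos (by exact_mod_cast hc₀neg) (hgpos _ hc₀)
    have h3 : (e c : ℚ) / (g c : ℚ) < 0 := lt_of_le_of_lt h1 h2
    have h4 : (e c : ℚ) < 0 := by
      by_contra h
      exact absurd h3 (not_lt.2 (div_nonneg (not_lt.1 h) (hgpos _ hcC).le))
    exact_mod_cast h4
  obtain ⟨δ, hδ⟩ : ∃ δ : ℕ, e c = -δ := ⟨(-e c).toNat, by omega⟩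
  have hδ1 : 1 ≤ δ := by omega
  have hratio : ∀ d ∈ C, -(e d) * (g c : ℤ) ≤ (g d : ℤ) * δ := by
    intro d hd
    have h1 := hmin d (by simpa using hd)
    rw [div_le_div_iff₀ (hgpos _ hcC) (hgpos _ hd)] at h1
    have h2 : e c * (g d : ℤ) ≤ e d * (g c : ℤ) := by exact_mod_cast h1
    rw [hδ] at h2
    linarith
  have hδg : δ ≤ g c := by
    have := (abs_le.1 (abs_effect_le nx hf c.1 c.2)).1
    have h2 : e c = effect nx f c.1 c.2 := rfl
    have : (δ : ℤ) ≤ (g c : ℤ) := by simp only [hg]; linarith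
    exact_mod_cast this
  obtain ⟨hcyc, -, hcl, hcvis⟩ := hC c hcC
  obtain ⟨C₁, C₂, hperm, hC₁, S, hS⟩ := exists_perm_append_dvd_sum e (by omega : 0 < δ) C
  have hmem₁ : ∀ d ∈ C₁, d ∈ C := fun d hd => hperm.mem_iff.2 (by simp [hd])
  have hmem₂ : ∀ d ∈ C₂, d ∈ C := fun d hd => hperm.mem_iff.2 (by simp [hd])
  have hsum : (C.map e).sum = (C₁.map e).sum + δ * S := by
    rw [(hperm.map e).sum_eq, List.map_append, List.sum_append, hS]
  have hgsum : (C.map g).sum = (C₁.map g).sum + (C₂.map g).sum := by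
    rw [(hperm.map g).sum_eq, List.map_append, List.sum_append]
  have hC₁g : (C₁.map g).sum ≤ C₁.length * n := by
    have := List.sum_le_card_nsmul (C₁.map g) n (by
      intro x hx
      obtain ⟨d, hd, rfl⟩ := List.mem_map.1 hx
      exact (hC d (hmem₁ d hd)).2.2.1)
    simpa using this
  have hC₁e : -((C₁.map g).sum : ℤ) ≤ (C₁.map e).sum := by
    clear hgsum hsum hC₁g hC₁ hperm
    induction C₁ with
    | nil => simp
    | cons d D ih =>
      have h1 := ih fun x hx => hmem₁ x (List.mem_cons_of_mem _ hx)
      have h2 := (abs_le.1 (abs_effect_le nx hf d.1 d.2)).1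
      simp only [List.map_cons, List.sum_cons]
      rw [Nat.cast_add]
      simp only [he, hg] at h1 ⊢
      linarith
  have hC₂g : -(C₂.map e).sum * (g c : ℤ) ≤ ((C₂.map g).sum : ℤ) * δ := by
    clear hgsum hsum hperm hS
    induction C₂ with
    | nil => simp
    | cons d D ih =>
      have h1 := ih fun x hx => hmem₂ x (List.mem_cons_of_mem _ hx)
      have h2 := hratio d (hmem₂ d List.mem_cons_self)
      simp only [List.map_cons, List.sum_cons]
      rw [Nat.cast_add]
      linarith
  have hδn : δ ≤ n := hδg.trans hcl
  have hC₁n : (C₁.map g).sum ≤ n * n :=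
    hC₁g.trans (Nat.mul_le_mul_right _ (by omega))
  have hSneg : S ≤ 0 := by
    have h1 : ((C₁.map g).sum : ℤ) ≤ n * n := by exact_mod_cast hC₁n
    have h2 : (δ : ℤ) * S < 0 := by linarith
    by_contra h
    have : 0 ≤ (δ : ℤ) * S := mul_nonneg (by omega) (by omega)
    omega
  obtain ⟨k, rfl⟩ : ∃ k : ℕ, S = -k := ⟨(-S).toNat, by omega⟩
  have hk : k * g c ≤ (C₂.map g).sum := by
    rw [hS] at hC₂g
    have h1 : (δ : ℤ) * (k * g c) ≤ δ * ((C₂.map g).sum : ℤ) := by linarith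
    have h2 := le_of_mul_le_mul_left h1 (by omega)
    exact_mod_cast h2
  obtain ⟨u, hu1, hu2, hu3, hu4⟩ := exists_insert_cycles (nx := nx) (f := f) p s C₁
    fun d hd => ⟨(hC d (hmem₁ d hd)).1, (hC d (hmem₁ d hd)).2.2.2⟩
  obtain ⟨u₁, u₂, rfl, hr⟩ := (visits_iff nx p u c.1).1 (hu4 _ hcvis)
  rw [List.length_append] at hu2
  have hu2' : u₁.length + u₂.length = s.length + (C₁.map g).sum := hu2
  have hlen' : s.length + (C.map g).sum = v.length := hlen
  refine ⟨u₁, c.2, u₂, k, δ, hδ1, hδg, hcl, ?_, ?_, ?_, ?_, ?_, ?_⟩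
  · rw [hr, hcyc]
  · rw [hr]
    exact hδ
  · rw [← state_append, hu1, hst]
  · rw [effect_append] at hu3
    have h3 : effect nx f p u₁ + effect nx f (state nx p u₁) u₂ =
      effect nx f p s + (C₁.map e).sum := hu3
    have h4 : effect nx f p s + (C.map e).sum = effect nx f p v := heff
    rw [hsum] at h4
    linarith
  · simp only [hg] at hk hu2' hgsum hlen'
    omega
  · have : 2 * n ^ 2 = n * n + n * n := by ring
    omega

section Cuts

variable {Q A S : Type} [Field S]

/-- One step of a dwROCA on a state and a counter value. -/
def cstep (M : DWROCA A S) (x : M.Q × ℕ) (a : A) : M.Q × ℕ :=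
  (M.next x.1 (decide (x.2 = 0)) a, ((x.2 : ℤ) + M.upd x.1 (decide (x.2 = 0)) a).toNat)

/-- The run of a dwROCA on a state and a counter value. -/
def crun (M : DWROCA A S) (x : M.Q × ℕ) (w : List A) : M.Q × ℕ := w.foldl (cstep M) x

/-- The transition function of a dwROCA at positive counter values. -/
def hnext (M : DWROCA A S) (q : M.Q) (a : A) : M.Q := M.next q false a

/-- The counter update of a dwROCA at positive counter values. -/
def hupd (M : DWROCA A S) (q : M.Q) (a : A) : ℤ := M.upd q false a

variable (M : DWROCA A S)

@[simp] lemma crun_nil (x : M.Q × ℕ) : crun M x [] = x := rfl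

@[simp] lemma crun_cons (x : M.Q × ℕ) (a : A) (w : List A) :
    crun M x (a :: w) = crun M (cstep M x a) w := rfl

lemma crun_append (x : M.Q × ℕ) (v w : List A) :
    crun M x (v ++ w) = crun M (crun M x v) w := by
  simp [crun]

lemma abs_upd_le (q : M.Q) (b : Bool) (a : A) : |M.upd q b a| ≤ 1 := by
  have h := M.upd_mem q b a
  simp only [Set.mem_insert_iff, Set.mem_singleton_iff] at h
  rcases h with h | h | h <;> simp [h]

lemma abs_hupd_le (q : M.Q) (a : A) : |hupd M q a| ≤ 1 := abs_upd_le M q false a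

lemma cstep_snd_le (x : M.Q × ℕ) (a : A) : (cstep M x a).2 ≤ x.2 + 1 := by
  have := (abs_le.1 (abs_upd_le M x.1 (decide (x.2 = 0)) a)).2
  simp only [cstep]
  omega

lemma le_cstep_snd (x : M.Q × ℕ) (a : A) : x.2 ≤ (cstep M x a).2 + 1 := by
  have := (abs_le.1 (abs_upd_le M x.1 (decide (x.2 = 0)) a)).1
  simp only [cstep]
  omega

lemma crun_snd_le (x : M.Q × ℕ) (w : List A) : (crun M x w).2 ≤ x.2 + w.length := by
  induction w generalizing x with
  | nil => simp
  | cons a w ih =>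
    have h1 := ih (cstep M x a)
    have h2 := cstep_snd_le M x a
    simp only [crun_cons, List.length_cons]
    omega

lemma le_crun_snd (x : M.Q × ℕ) (w : List A) : x.2 ≤ (crun M x w).2 + w.length := by
  induction w generalizing x with
  | nil => simp
  | cons a w ih =>
    have h1 := ih (cstep M x a)
    have h2 := le_cstep_snd M x a
    simp only [crun_cons, List.length_cons]
    omega

lemma crun_take_succ_snd (x : M.Q × ℕ) (w : List A) (i : ℕ) :
    (crun M x (w.take (i + 1))).2 ≤ (crun M x (w.take i)).2 + 1 ∧
      (crun M x (w.take i)).2 ≤ (crun M x (w.take (i + 1))).2 + 1 := by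
  rw [List.take_add, crun_append]
  have h1 := crun_snd_le M (crun M x (w.take i)) ((w.drop i).take 1)
  have h2 := le_crun_snd M (crun M x (w.take i)) ((w.drop i).take 1)
  have h3 : ((w.drop i).take 1).length ≤ 1 := by simp
  omega

lemma cstep_of_pos {q : M.Q} {n : ℕ} (hn : 0 < n) (a : A) :
    cstep M (q, n) a = (hnext M q a, ((n : ℤ) + hupd M q a).toNat) := by
  simp [cstep, hnext, hupd, Nat.pos_iff_ne_zero.1 hn]

/-- A run that stays positive follows the transitions for positive counter values. -/
lemma crun_eq_of_pos (q : M.Q) (n : ℕ) (w : List A)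
    (h : ∀ i < w.length, 0 < (crun M (q, n) (w.take i)).2) :
    (crun M (q, n) w).1 = state (hnext M) q w ∧
      ((crun M (q, n) w).2 : ℤ) = n + effect (hnext M) (hupd M) q w := by
  induction w generalizing q n with
  | nil => simp
  | cons a w ih =>
    have hn : 0 < n := by simpa using h 0 (by simp)
    have hu := (abs_le.1 (abs_hupd_le M q a)).1
    have := ih (hnext M q a) ((n : ℤ) + hupd M q a).toNat (by
      intro i hi
      have := h (i + 1) (by simpa using hi)
      simpa [cstep_of_pos M hn] using this)
    rw [crun_cons, cstep_of_pos M hn, this.1, this.2]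
    refine ⟨rfl, ?_⟩
    rw [effect_cons]
    omega

lemma crun_eq_of_le (q : M.Q) (n : ℕ) (w : List A) (h : w.length ≤ n) :
    (crun M (q, n) w).1 = state (hnext M) q w ∧
      ((crun M (q, n) w).2 : ℤ) = n + effect (hnext M) (hupd M) q w := by
  apply crun_eq_of_pos
  intro i hi
  have := le_crun_snd M (q, n) (w.take i)
  simp only [List.length_take] at this
  omega

/-- A run that stays above `a` can be shifted down by `a`. -/
lemma crun_shift (q : M.Q) (n a : ℕ) (w : List A)
    (h : ∀ i < w.length, a < (crun M (q, n + a) (w.take i)).2) :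
    (crun M (q, n + a) w).1 = (crun M (q, n) w).1 ∧
      (crun M (q, n + a) w).2 = (crun M (q, n) w).2 + a := by
  induction w generalizing q n with
  | nil => simp
  | cons b w ih =>
    have hn : 0 < n := by simpa using h 0 (by simp)
    have hu := (abs_le.1 (abs_hupd_le M q b)).1
    have e : (((n + a : ℕ) : ℤ) + hupd M q b).toNat = ((n : ℤ) + hupd M q b).toNat + a := by
      omega
    have := ih (hnext M q b) ((n : ℤ) + hupd M q b).toNat (by
      intro i hi
      have := h (i + 1) (by simpa using hi)
      rwa [List.take_succ_cons, crun_cons, cstep_of_pos M (show 0 < n + a by omega), e]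
        at this)
    rw [crun_cons, cstep_of_pos M (show 0 < n + a by omega), e, this.1, this.2, crun_cons,
      cstep_of_pos M hn]
    exact ⟨rfl, rfl⟩

variable {M} in
/-- Iterating a cycle with drop `δ`. -/
lemma crun_rep {q : M.Q} {γ : List A} {δ c : ℕ} (hγ : state (hnext M) q γ = q)
    (hδ : effect (hnext M) (hupd M) q γ = -δ) (hc : γ.length ≤ c + δ) (k : ℕ) :
    crun M (q, c + k * δ) (rep γ k) = (q, c) := by
  induction k with
  | zero => simp
  | succ k ih =>
    have hle : γ.length ≤ c + (k + 1) * δ := by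
      rw [Nat.add_mul]
      omega
    have h := crun_eq_of_le M q (c + (k + 1) * δ) γ hle
    have h2 : crun M (q, c + (k + 1) * δ) γ = (q, c + k * δ) := by
      ext
      · rw [h.1, hγ]
      · have := h.2
        rw [hδ] at this
        push_cast at this
        zify
        linarith
    rw [rep_succ, crun_append, h2, ih]

lemma crun_take_split (x : M.Q × ℕ) (w : List A) {i j : ℕ} (hij : i ≤ j) :
    crun M x (w.take j) = crun M (crun M x (w.take i)) ((w.drop i).take (j - i)) := by
  rw [← crun_append, ← List.take_add, Nat.add_sub_cancel' hij]

lemma crun_take_drop (x : M.Q × ℕ) (w : List A) (i : ℕ) :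
    crun M x w = crun M (crun M x (w.take i)) (w.drop i) := by
  rw [← crun_append, List.take_append_drop]

/-- Removing the part between the times `r` and `s` of a run, when the states agree at these
times and the counter stays above the difference `a` of the counter values from `s` to `j`. -/
lemma crun_cut (x : M.Q × ℕ) (w : List A) {r s j : ℕ} (a : ℕ) (hsj : s ≤ j)
    (hq : (crun M x (w.take r)).1 = (crun M x (w.take s)).1)
    (ha : (crun M x (w.take r)).2 + a = (crun M x (w.take s)).2)
    (hpos : ∀ t, s ≤ t → t < j → a < (crun M x (w.take t)).2) :
    (crun M x (w.take r ++ (w.drop s).take (j - s))).1 = (crun M x (w.take j)).1 ∧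
      (crun M x (w.take r ++ (w.drop s).take (j - s))).2 + a = (crun M x (w.take j)).2 := by
  have hs : crun M x (w.take s) = ((crun M x (w.take r)).1, (crun M x (w.take r)).2 + a) := by
    ext
    · exact hq.symm
    · exact ha.symm
  have h := crun_shift M (crun M x (w.take r)).1 (crun M x (w.take r)).2 a
    ((w.drop s).take (j - s)) (by
      intro i hi
      simp only [List.length_take] at hi
      have := hpos (s + i) (by omega) (by omega)
      rw [crun_take_split M x w (show s ≤ s + i by omega), hs, Nat.add_sub_cancel_left] at this
      rwa [List.take_take, min_eq_left (by omega)])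
  rw [← hs, ← crun_take_split M x w hsj] at h
  rw [crun_append]
  exact ⟨h.1.symm, h.2.symm⟩

end Cuts

section Crossing

/-- The last time below a level. -/
lemma exists_last_up {g : ℕ → ℕ} {l t : ℕ} (hg : ∀ i, g (i + 1) ≤ g i + 1) (s : ℕ)
    (hst : s ≤ t) (h0 : g s ≤ l) (ht : l < g t) :
    ∃ u, s ≤ u ∧ u < t ∧ g u = l ∧ ∀ i, u < i → i ≤ t → l < g i := by
  induction t, hst using Nat.le_induction with
  | base => omega
  | succ t hst ih =>
    by_cases h : l < g t
    · obtain ⟨u, h1, h2, h3, h4⟩ := ih h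
      refine ⟨u, h1, by omega, h3, fun i hi hit => ?_⟩
      rcases Nat.lt_or_ge t i with h5 | h5
      · rwa [show i = t + 1 by omega]
      · exact h4 i hi h5
    · have := hg t
      refine ⟨t, hst, by omega, by omega, fun i hi hit => ?_⟩
      rwa [show i = t + 1 by omega]

/-- The first time below a level. -/
lemma exists_first_down {g : ℕ → ℕ} {l t e : ℕ} (hg : ∀ i, g i ≤ g (i + 1) + 1)
    (hte : t ≤ e) (ht : l < g t) (he : g e ≤ l) :
    ∃ d, t < d ∧ d ≤ e ∧ g d = l ∧ ∀ i, t ≤ i → i < d → l < g i := by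
  classical
  have hex : ∃ d, t ≤ d ∧ g d ≤ l := ⟨e, hte, he⟩
  obtain ⟨h1, h2⟩ := Nat.find_spec hex
  have h3 : ∀ i, t ≤ i → i < Nat.find hex → l < g i := fun i hi hid => by
    have := Nat.find_min hex hid
    push Not at this
    exact this hi
  have h4 : t ≠ Nat.find hex := fun h => by
    rw [← h] at h2
    omega
  have h5 := h3 (Nat.find hex - 1) (by omega) (by omega)
  have h6 := hg (Nat.find hex - 1)
  rw [Nat.sub_add_cancel (by omega)] at h6
  exact ⟨Nat.find hex, by omega, Nat.find_min' hex ⟨hte, he⟩, by omega, h3⟩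

end Crossing

section Shortest

variable {A S : Type} [Field S] {M : DWROCA A S} {Tg : M.Q × ℕ → Prop} {K : ℕ}

variable (M Tg) in
/-- Some word of length at most `d` leads from `x` to the target `Tg`. -/
def Reach (d : ℕ) (x : M.Q × ℕ) : Prop := ∃ v : List A, v.length ≤ d ∧ Tg (crun M x v)

lemma Reach.mono {d e : ℕ} {x : M.Q × ℕ} (h : Reach M Tg d x) (hde : d ≤ e) :
    Reach M Tg e x := by
  obtain ⟨v, h1, h2⟩ := h
  exact ⟨v, h1.trans hde, h2⟩

variable (M Tg) in
/-- The word `v` is a shortest word leading from `x` to `Tg`. -/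
def Shortest (x : M.Q × ℕ) (v : List A) : Prop :=
  Tg (crun M x v) ∧ ∀ v', Tg (crun M x v') → v.length ≤ v'.length

lemma exists_shortest {d : ℕ} {x : M.Q × ℕ} (h : Reach M Tg d x) :
    ∃ v, Shortest M Tg x v ∧ v.length ≤ d := by
  classical
  have hex : ∃ n, ∃ v : List A, v.length = n ∧ Tg (crun M x v) := by
    obtain ⟨v, -, hv⟩ := h
    exact ⟨_, v, rfl, hv⟩
  obtain ⟨v, hv1, hv2⟩ := Nat.find_spec hex
  have hmin : ∀ v', Tg (crun M x v') → v.length ≤ v'.length := fun v' hv' =>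
    hv1 ▸ Nat.find_min' hex ⟨v', rfl, hv'⟩
  obtain ⟨u, hu1, hu2⟩ := h
  exact ⟨v, ⟨hv2, hmin⟩, (hmin u hu2).trans hu1⟩

/-- A shortest run to a target with small counter values does not climb high. -/
lemma Shortest.height_le (hTg : ∀ x, Tg x → x.2 < K) {x : M.Q × ℕ} {v : List A}
    (hv : Shortest M Tg x v) (t : ℕ) (ht : t ≤ v.length) :
    (crun M x (v.take t)).2 ≤ max x.2 K + Fintype.card M.Q ^ 2 := by
  classical
  by_contra hcon
  push Not at hcon
  set n := Fintype.card M.Q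
  set b := max x.2 K with hb
  set g : ℕ → ℕ := fun i => (crun M x (v.take i)).2 with hg
  have hK : 0 < K := by
    have := hTg _ hv.1
    omega
  have hend : g v.length < K := by
    have := hTg _ hv.1
    simpa [hg] using this
  have hup : ∀ l, ∃ u, b ≤ l → l ≤ b + n ^ 2 → u < t ∧ g u = l ∧
      ∀ i, u < i → i ≤ t → l < g i := by
    intro l
    by_cases hl : b ≤ l ∧ l ≤ b + n ^ 2
    · obtain ⟨u, -, h⟩ := exists_last_up (g := g) (l := l) (t := t)
        (fun i => (crun_take_succ_snd M x v i).1) 0 (Nat.zero_le _)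
        (by simp only [hg, List.take_zero, crun_nil]; omega) (lt_of_le_of_lt hl.2 hcon)
      exact ⟨u, fun _ _ => h⟩
    · exact ⟨0, fun h1 h2 => absurd ⟨h1, h2⟩ hl⟩
  have hdown : ∀ l, ∃ d, b ≤ l → l ≤ b + n ^ 2 → t < d ∧ d ≤ v.length ∧ g d = l ∧
      ∀ i, t ≤ i → i < d → l < g i := by
    intro l
    by_cases hl : b ≤ l ∧ l ≤ b + n ^ 2
    · obtain ⟨d, h⟩ := exists_first_down (g := g) (l := l)
        (fun i => (crun_take_succ_snd M x v i).2) ht (lt_of_le_of_lt hl.2 hcon) (by omega)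
      exact ⟨d, fun _ _ => h⟩
    · exact ⟨0, fun h1 h2 => absurd ⟨h1, h2⟩ hl⟩
  choose u hu using hup
  choose d hd using hdown
  obtain ⟨i, i', hne, hii⟩ := Fintype.exists_ne_map_eq_of_card_lt
    (fun i : Fin (n ^ 2 + 1) => ((crun M x (v.take (u (b + i)))).1,
      (crun M x (v.take (d (b + i)))).1)) (by
        rw [Fintype.card_prod, Fintype.card_fin]
        have : n ^ 2 = Fintype.card M.Q * Fintype.card M.Q := sq _
        omega)
  wlog hlt : i < i' generalizing i i'
  · exact this i' i hne.symm hii.symm (lt_of_le_of_ne (not_lt.1 hlt) hne.symm)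
  have hlt' : (i : ℕ) < i' := hlt
  have hi := i.2
  have hi' := i'.2
  rw [Prod.mk.injEq] at hii
  obtain ⟨hs1, hs2⟩ := hii
  set l := b + (i : ℕ)
  set l' := b + (i' : ℕ)
  obtain ⟨u1, u2, u3⟩ := hu l (by omega) (by omega)
  obtain ⟨u1', u2', u3'⟩ := hu l' (by omega) (by omega)
  obtain ⟨d1, d2, d3, d4⟩ := hd l (by omega) (by omega)
  obtain ⟨d1', d2', d3', d4'⟩ := hd l' (by omega) (by omega)
  have huu : u l < u l' := by
    rcases lt_trichotomy (u l) (u l') with h | h | h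
    · exact h
    · rw [h] at u2
      omega
    · have := u3' _ h u1.le
      omega
  have hdd : d l' < d l := by
    rcases lt_trichotomy (d l') (d l) with h | h | h
    · exact h
    · rw [h] at d3'
      omega
    · have := d4' _ d1.le h
      omega
  have hge : ∀ i, u l' ≤ i → i < d l' → l' - l < g i := by
    intro i h1 h2
    rcases Nat.lt_or_ge i t with h | h
    · rcases Nat.eq_or_lt_of_le h1 with h3 | h3
      · rw [← h3]
        omega
      · have := u3' i h3 h.le
        omega
    · have := d4' i h h2
      omega
  have hcut := crun_cut M x v (r := u l) (s := u l') (j := d l') (l' - l) (by omega) hs1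
    (by change g (u l) + _ = g (u l'); omega) hge
  have hmid : crun M x (v.take (u l) ++ (v.drop (u l')).take (d l' - u l')) =
      crun M x (v.take (d l)) := by
    ext
    · rw [hcut.1, hs2]
    · have h1 := hcut.2
      have h2 : (crun M x (v.take (d l'))).2 = l' := d3'
      have h3 : (crun M x (v.take (d l))).2 = l := d3
      omega
  have hfin : Tg (crun M x ((v.take (u l) ++ (v.drop (u l')).take (d l' - u l')) ++
      v.drop (d l))) := by
    rw [crun_append, hmid, ← crun_take_drop]
    exact hv.1
  have := hv.2 _ hfin
  simp only [List.length_append, List.length_take, List.length_drop] at this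
  omega

/-- A shortest run to a target with small counter values is short. -/
lemma Shortest.length_lt (hTg : ∀ x, Tg x → x.2 < K) {x : M.Q × ℕ} {v : List A}
    (hv : Shortest M Tg x v) :
    v.length < Fintype.card M.Q * (max x.2 K + Fintype.card M.Q ^ 2 + 1) := by
  classical
  set H := max x.2 K + Fintype.card M.Q ^ 2 + 1
  by_contra hcon
  push Not at hcon
  obtain ⟨i, i', hne, hii⟩ := Fintype.exists_ne_map_eq_of_card_lt
    (fun i : Fin (v.length + 1) => (((crun M x (v.take i)).1,
      ⟨(crun M x (v.take i)).2, Nat.lt_succ_of_le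
        (hv.height_le hTg i (Nat.lt_succ_iff.1 i.2))⟩) : M.Q × Fin H)) (by
      rw [Fintype.card_prod, Fintype.card_fin, Fintype.card_fin]
      omega)
  wlog hlt : i < i' generalizing i i'
  · exact this i' i hne.symm hii.symm (lt_of_le_of_ne (not_lt.1 hlt) hne.symm)
  have hlt' : (i : ℕ) < i' := hlt
  have hi' := i'.2
  simp only [Prod.mk.injEq, Fin.mk.injEq] at hii
  have hmid : crun M x (v.take i) = crun M x (v.take i') := Prod.ext hii.1 hii.2
  have hfin : Tg (crun M x (v.take i ++ v.drop i')) := by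
    rw [crun_append, hmid, ← crun_take_drop]
    exact hv.1
  have := hv.2 _ hfin
  simp only [List.length_append, List.length_take, List.length_drop] at this
  omega

/-- A shortest run from a high counter value iterates a short cycle with positive drop, and
the number of iterations can be adapted to the counter value. -/
lemma Shortest.exists_pump (hTg : ∀ x, Tg x → x.2 < K) (hcard : Fintype.card M.Q < K)
    {p : M.Q} {m : ℕ} {v : List A} (hv : Shortest M Tg (p, m) v) (hm : 6 * K ^ 2 ≤ m) :
    ∃ (pre γ post : List A) (k δ c : ℕ),
      1 ≤ δ ∧ δ ≤ γ.length ∧ γ.length ≤ Fintype.card M.Q ∧ pre.length ≤ 2 * K ^ 2 ∧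
      state (hnext M) (state (hnext M) p pre) γ = state (hnext M) p pre ∧
      effect (hnext M) (hupd M) (state (hnext M) p pre) γ = -δ ∧
      (m : ℤ) + effect (hnext M) (hupd M) p pre = c + k * δ ∧
      (∀ m₂ k' : ℕ, (m₂ : ℤ) + effect (hnext M) (hupd M) p pre = c + k' * δ →
        Tg (crun M (p, m₂) (pre ++ (rep γ k' ++ post)))) ∧
      pre.length + k * γ.length + post.length = v.length ∧
      |(δ : ℤ) * v.length - γ.length * m| ≤ δ * (6 * K ^ 3) ∧
      m ≤ k * δ + 6 * K ^ 2 := by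
  classical
  set n := Fintype.card M.Q with hn
  set x : M.Q × ℕ := (p, m) with hx
  set g : ℕ → ℕ := fun i => (crun M x (v.take i)).2 with hg
  have hn0 : 0 < n := Fintype.card_pos_iff.mpr ⟨p⟩
  have hK2 : K ≤ K ^ 2 := by nlinarith
  have hnK : n ^ 2 + n ≤ K ^ 2 := by nlinarith
  have hend : g v.length < K := by
    have := hTg _ hv.1
    simpa [hg] using this
  obtain ⟨t, -, ht2, ht3, ht4⟩ := exists_first_down (g := g) (l := 4 * K ^ 2) (t := 0)
    (fun i => (crun_take_succ_snd M x v i).2) (Nat.zero_le v.length)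
    (by simp only [hg, List.take_zero, crun_nil, hx]; nlinarith) (by omega)
  have hhigh := crun_eq_of_pos M p m (v.take t) (by
    intro i hi
    rw [List.length_take] at hi
    have := ht4 i (Nat.zero_le _) (by omega)
    rw [List.take_take, min_eq_left (by omega)]
    exact lt_of_le_of_lt (Nat.zero_le _) this)
  have hrun : crun M x (v.take t) = (state (hnext M) p (v.take t), 4 * K ^ 2) :=
    Prod.ext hhigh.1 ht3
  have heff : (4 * K ^ 2 : ℤ) = m + effect (hnext M) (hupd M) p (v.take t) := by
    rw [← hhigh.2, ← hx, hrun]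
    push_cast
    ring
  have hdrop : (2 * n ^ 2 : ℤ) ≤ -effect (hnext M) (hupd M) p (v.take t) := by
    have h1 : (6 * K ^ 2 : ℤ) ≤ m := by exact_mod_cast hm
    have h2 : (n ^ 2 + n : ℤ) ≤ K ^ 2 := by exact_mod_cast hnK
    linarith
  obtain ⟨pre, γ, post, k, δ, hδ1, hδγ, hγn, hγ, hγe, hpost, hsum, hlen, hshort⟩ :=
    exists_normal_form (abs_hupd_le M) p (v.take t) hdrop
  rw [← hn] at hγn hshort
  have hpre_e := abs_le.1 (abs_effect_le (hnext M) (abs_hupd_le M) p pre)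
  have hpost_e := abs_le.1 (abs_effect_le (hnext M) (abs_hupd_le M)
    (state (hnext M) p pre) post)
  set ep := effect (hnext M) (hupd M) p pre with hep
  set eo := effect (hnext M) (hupd M) (state (hnext M) p pre) post with heo
  have hshort' : (pre.length : ℤ) + post.length ≤ 2 * n ^ 2 := by exact_mod_cast hshort
  have hnK' : (n ^ 2 + n : ℤ) ≤ K ^ 2 := by exact_mod_cast hnK
  have hn1 : (1 : ℤ) ≤ n := by exact_mod_cast hn0
  have hn2 : (0 : ℤ) ≤ (n : ℤ) ^ 2 := sq_nonneg _
  have hpre0 : (0 : ℤ) ≤ pre.length := Int.natCast_nonneg _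
  have hpost0 : (0 : ℤ) ≤ post.length := Int.natCast_nonneg _
  have hγn' : (γ.length : ℤ) ≤ n := by exact_mod_cast hγn
  obtain ⟨c, hc⟩ : ∃ c : ℕ, (c : ℤ) = 4 * K ^ 2 - eo :=
    ⟨(4 * K ^ 2 - eo).toNat, by rw [Int.toNat_of_nonneg]; linarith⟩
  -- the adapted runs
  have hadapt : ∀ m₂ k' : ℕ, (m₂ : ℤ) + ep = c + k' * δ →
      Tg (crun M (p, m₂) (pre ++ (rep γ k' ++ (post ++ v.drop t)))) := by
    intro m₂ k' hmk
    have hkδ : (0 : ℤ) ≤ k' * δ := by positivity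
    have e1 : crun M (p, m₂) pre = (state (hnext M) p pre, c + k' * δ) := by
      have h := crun_eq_of_le M p m₂ pre (by zify; linarith)
      ext
      · exact h.1
      · have h2 := h.2
        rw [← hep, hmk] at h2
        exact_mod_cast h2
    have e2 := crun_rep (M := M) (c := c) hγ hγe (by zify; linarith) k'
    have e3 : crun M (state (hnext M) p pre, c) post = crun M x (v.take t) := by
      have h := crun_eq_of_le M (state (hnext M) p pre) c post (by zify; linarith)
      rw [hrun]
      ext
      · rw [h.1, hpost]
      · have h2 := h.2
        rw [← heo, hc] at h2
        zify
        linarith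
    rw [crun_append, e1, crun_append, e2, crun_append, e3, ← crun_take_drop]
    exact hv.1
  have hmk : (m : ℤ) + ep = c + k * δ := by
    rw [hc]
    linarith
  have hopt := hv.2 _ (hadapt m k hmk)
  simp only [List.length_append, length_rep, List.length_drop] at hopt
  rw [List.length_take, min_eq_left ht2] at hlen
  have hv2 : Shortest M Tg (crun M x (v.take t)) (v.drop t) := by
    refine ⟨by rw [← crun_take_drop]; exact hv.1, fun v' hv' => ?_⟩
    rw [← crun_append] at hv'
    have := hv.2 _ hv'
    simp only [List.length_append, List.length_take] at this
    rw [List.length_drop]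
    omega
  have hv2len := hv2.length_lt hTg
  rw [hrun, List.length_drop, ← hn] at hv2len
  simp only at hv2len
  rw [max_eq_left (by omega)] at hv2len
  have hd : pre.length + k * γ.length + (post ++ v.drop t).length = v.length := by
    simp only [List.length_append, List.length_drop]
    omega
  refine ⟨pre, γ, post ++ v.drop t, k, δ, c, hδ1, hδγ, hγn, by omega, hγ, hγe, hmk, hadapt,
    hd, ?_, ?_⟩
  · have hW : ((v.length - t : ℕ) : ℤ) < n * (4 * K ^ 2 + n ^ 2 + 1) := by
      exact_mod_cast hv2len
    have hW0 : (0 : ℤ) ≤ ((v.length - t : ℕ) : ℤ) := Int.natCast_nonneg _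
    set W : ℤ := pre.length + post.length + ((v.length - t : ℕ) : ℤ) with hWdef
    have hvW : (v.length : ℤ) = k * γ.length + W := by
      have hd' := congrArg (Nat.cast (R := ℤ)) hd
      rw [List.length_append, List.length_drop] at hd'
      simp only [Nat.cast_add, Nat.cast_mul] at hd'
      linarith
    have hnK1 : (n : ℤ) + 1 ≤ K := by exact_mod_cast hcard
    have hWle : W ≤ 6 * K ^ 3 := by
      have h1 : (n : ℤ) * (4 * K ^ 2 + n ^ 2 + 1) ≤ (K - 1) * (5 * K ^ 2) :=
        mul_le_mul (by linarith) (by linarith) (by positivity) (by linarith)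
      have h2 : (K : ℤ) ^ 2 ≤ K ^ 3 := pow_le_pow_right₀ (by linarith) (by norm_num)
      have h3 : ((K : ℤ) - 1) * (5 * K ^ 2) = 5 * K ^ 3 - 5 * K ^ 2 := by ring
      linarith
    have hV0 : (0 : ℤ) ≤ 4 * K ^ 2 - eo - ep := by linarith
    have hV : (γ.length : ℤ) * (4 * K ^ 2 - eo - ep) ≤ 6 * K ^ 3 := by
      have : (γ.length : ℤ) * (4 * K ^ 2 - eo - ep) ≤ K * (6 * K ^ 2) :=
        mul_le_mul (by linarith) (by linarith) hV0 (by linarith)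
      linarith
    have hV1 : (0 : ℤ) ≤ (γ.length : ℤ) * (4 * K ^ 2 - eo - ep) := mul_nonneg (by positivity) hV0
    have hδ1' : (1 : ℤ) ≤ δ := by exact_mod_cast hδ1
    have hδW : (δ : ℤ) * W ≤ δ * (6 * K ^ 3) := mul_le_mul_of_nonneg_left hWle (by linarith)
    have hδW0 : (0 : ℤ) ≤ δ * W := mul_nonneg (by linarith) (by linarith)
    have hK3 : (6 * K ^ 3 : ℤ) ≤ δ * (6 * K ^ 3) := le_mul_of_one_le_left (by positivity) hδ1'
    have hkey : (δ : ℤ) * v.length - γ.length * m =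
        δ * W - γ.length * (4 * K ^ 2 - eo - ep) := by
      have : (m : ℤ) = 4 * K ^ 2 - eo + k * δ - ep := by linarith
      rw [hvW, this]
      ring
    rw [hkey, abs_le]
    constructor <;> linarith
  · zify
    linarith

end Shortest

/-- The pair `(m, n)` lies in a belt around the line `P * m = R * n`. -/
def Belt (P R F m n : ℤ) : Prop := |P * m - R * n| ≤ F * min P R

section Belt

variable {P R P' R' T F F' m n m' n' H : ℤ}

lemma Belt.swap (h : Belt P R F m n) : Belt R P F n m := by
  unfold Belt at *
  rwa [abs_sub_comm, min_comm]

/-- A belt that nearly touches another one far from the origin has the same slope. -/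
lemma Belt.transfer (hP : 1 ≤ P) (hPT : P ≤ T) (hR : 1 ≤ R) (hRT : R ≤ T) (hP' : 1 ≤ P')
    (hPT' : P' ≤ T) (hR' : 1 ≤ R') (hRT' : R' ≤ T) (hF : 0 ≤ F) (hF' : 0 ≤ F')
    (h : Belt P R F m n) (h' : Belt P' R' F' m' n') (hm : |m - m'| ≤ 1) (hn : |n - n'| ≤ 1)
    (hbig : T ^ 2 * (F + F' + 2) < max m' n') : Belt P R F' m' n' := by
  have hT : 1 ≤ T := hP.trans hPT
  have hF1 : F * min P R ≤ F * T :=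
    mul_le_mul_of_nonneg_left ((min_le_left _ _).trans hPT) hF
  have hF2 : F' * min P' R' ≤ F' * T :=
    mul_le_mul_of_nonneg_left ((min_le_left _ _).trans hPT') hF'
  have he1 : |P * m' - R * n'| ≤ F * T + 2 * T := by
    have e : P * m' - R * n' = (P * m - R * n) - P * (m - m') + R * (n - n') := by ring
    have h1 : |P * (m - m')| ≤ T := by
      rw [abs_mul, abs_of_pos (by linarith)]
      nlinarith [abs_nonneg (m - m')]
    have h2 : |R * (n - n')| ≤ T := by
      rw [abs_mul, abs_of_pos (by linarith)]
      nlinarith [abs_nonneg (n - n')]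
    have h3 : |P * m - R * n| ≤ F * T := h.trans hF1
    rw [abs_le] at h1 h2 h3 ⊢
    rw [e]
    constructor <;> linarith
  have he2 : |P' * m' - R' * n'| ≤ F' * T := h'.trans hF2
  have key : ∀ a b : ℤ, 1 ≤ a → a ≤ T → 1 ≤ b → b ≤ T →
      a * (P * m' - R * n') - b * (P' * m' - R' * n') ≤ T ^ 2 * (F + F' + 2) ∧
      -(T ^ 2 * (F + F' + 2)) ≤ a * (P * m' - R * n') - b * (P' * m' - R' * n') := by
    intro a b ha haT hb hbT
    have h1 : |a * (P * m' - R * n')| ≤ T * (F * T + 2 * T) := by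
      rw [abs_mul, abs_of_pos (by linarith)]
      exact mul_le_mul haT he1 (abs_nonneg _) (by linarith)
    have h2 : |b * (P' * m' - R' * n')| ≤ T * (F' * T) := by
      rw [abs_mul, abs_of_pos (by linarith)]
      exact mul_le_mul hbT he2 (abs_nonneg _) (by linarith)
    rw [abs_le] at h1 h2
    have e : T ^ 2 * (F + F' + 2) = T * (F * T + 2 * T) + T * (F' * T) := by ring
    rw [e]
    constructor <;> linarith
  have hD : P * R' = P' * R := by
    by_contra hne
    have hpos : 0 ≤ T ^ 2 * (F + F' + 2) := by positivity
    have hcase : ∀ z : ℤ, T ^ 2 * (F + F' + 2) < z →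
        (P * R' - P' * R) * z ≤ T ^ 2 * (F + F' + 2) →
        -(T ^ 2 * (F + F' + 2)) ≤ (P * R' - P' * R) * z → False := by
      intro z hz h1 h2
      rcases lt_or_gt_of_ne hne with h3 | h3
      · nlinarith
      · nlinarith
    rcases lt_max_iff.1 hbig with hb | hb
    · obtain ⟨k1, k2⟩ := key R' R hR' hRT' hR hRT
      have e : R' * (P * m' - R * n') - R * (P' * m' - R' * n') = (P * R' - P' * R) * m' := by
        ring
      rw [e] at k1 k2
      exact hcase m' hb k1 k2
    · obtain ⟨k1, k2⟩ := key P' P hP' hPT' hP hPT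
      have e : P' * (P * m' - R * n') - P * (P' * m' - R' * n') = (P * R' - P' * R) * n' := by
        ring
      rw [e] at k1 k2
      exact hcase n' hb k1 k2
  have h1 : P' * (P * m' - R * n') = P * (P' * m' - R' * n') := by
    linear_combination n' * hD
  have h2 : P * min P' R' = P' * min P R := by
    rw [mul_min_of_nonneg _ _ (by linarith), mul_min_of_nonneg _ _ (by linarith), hD,
      mul_comm P P']
  have h3 : P' * |P * m' - R * n'| ≤ P' * (F' * min P R) := by
    calc P' * |P * m' - R * n'| = P * |P' * m' - R' * n'| := by
          rw [← abs_of_pos (show 0 < P' by linarith), ← abs_mul, abs_of_pos (show 0 < P' by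
            linarith), h1, abs_mul, abs_of_pos (show 0 < P by linarith)]
      _ ≤ P * (F' * min P' R') := mul_le_mul_of_nonneg_left h' (by linarith)
      _ = P' * (F' * min P R) := by linear_combination F' * h2
  exact le_of_mul_le_mul_left h3 (by linarith)

/-- Far from the origin, both coordinates of a point in a belt are large. -/
lemma Belt.lower (hP : 1 ≤ P) (hPT : P ≤ T) (hR : 1 ≤ R) (hF : 0 ≤ F)
    (hH : 0 ≤ H) (h : Belt P R F m n) (hmax : H ≤ max m n) :
    H * min P R ≤ T * (m + F) := by
  have hmin1 := min_le_left P R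
  have hmin2 := min_le_right P R
  have hmin0 : 0 ≤ min P R := le_min (by linarith) (by linarith)
  rcases le_max_iff.1 hmax with h1 | h1
  · calc H * min P R ≤ H * T := mul_le_mul_of_nonneg_left (hmin1.trans hPT) hH
      _ = T * H := mul_comm _ _
      _ ≤ T * (m + F) := mul_le_mul_of_nonneg_left (by linarith) (by linarith)
  · have h2 := (abs_le.1 h).1
    have h3 : R * H ≤ P * (m + F) := by
      have e1 : R * H ≤ R * n := mul_le_mul_of_nonneg_left h1 (by linarith)
      have e2 : F * min P R ≤ F * P := mul_le_mul_of_nonneg_left hmin1 hF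
      linarith
    have h4 : H * min P R ≤ R * H := by
      rw [mul_comm]
      exact mul_le_mul_of_nonneg_right hmin2 hH
    have h5 : 0 ≤ m + F := by
      have : 0 ≤ P * (m + F) := le_trans (mul_nonneg (by linarith) hH) h3
      exact nonneg_of_mul_nonneg_right this (by linarith)
    exact (h4.trans h3).trans (mul_le_mul_of_nonneg_right hPT h5)

lemma Belt.comb {m₁ n₁ m₂ n₂ m₃ n₃ : ℤ} (h₁ : Belt P R F m₁ n₁) (h₂ : Belt P R F m₂ n₂)
    (h₃ : Belt P R F m₃ n₃) : Belt P R (3 * F) (m₁ - m₂ + m₃) (n₁ - n₂ + n₃) := by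
  unfold Belt at *
  rw [abs_le] at *
  constructor <;> linarith

/-- A large increase of one coordinate inside a belt forces an increase of the other one. -/
lemma Belt.increase {m₁ n₁ m₂ n₂ : ℤ} (hR : 1 ≤ R) (hP : 1 ≤ P) (hF : 0 ≤ F)
    (h₁ : Belt P R F m₁ n₁)
    (h₂ : Belt P R F m₂ n₂) (h : n₁ + (2 * F + 1) ≤ n₂) : m₁ < m₂ := by
  unfold Belt at *
  rw [abs_le] at *
  have h3 : R * (2 * F + 1) ≤ R * (n₂ - n₁) := mul_le_mul_of_nonneg_left (by linarith)
    (by linarith)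
  have h4 : F * min P R ≤ F * R := mul_le_mul_of_nonneg_left (min_le_right _ _) hF
  have h5 : 0 < P * (m₂ - m₁) := by linarith
  have := (mul_pos_iff_of_pos_left (by linarith)).1 h5
  linarith

end Belt

section Distance

variable {A S : Type} [Field S] {M N : DWROCA A S} {TM : M.Q × ℕ → Prop}
  {TN : N.Q × ℕ → Prop} {K : ℕ}

lemma Shortest.length_le_of_low (hTM : ∀ x, TM x → x.2 < K) (hcard : Fintype.card M.Q < K)
    {p : M.Q} {m : ℕ} {v : List A} (hv : Shortest M TM (p, m) v) (hm : m < 6 * K ^ 2) :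
    v.length ≤ 7 * K ^ 3 := by
  have h := hv.length_lt hTM
  set n := Fintype.card M.Q
  have hK : K ≤ 6 * K ^ 2 := by nlinarith
  have h1 : max m K + n ^ 2 + 1 ≤ 7 * K ^ 2 := by
    have : n ^ 2 + 1 ≤ K ^ 2 := by nlinarith
    have : max m K ≤ 6 * K ^ 2 := max_le hm.le hK
    omega
  have h2 : n * (max m K + n ^ 2 + 1) ≤ K * (7 * K ^ 2) := Nat.mul_le_mul hcard.le h1
  have h3 : K * (7 * K ^ 2) = 7 * K ^ 3 := by ring
  exact h.le.trans (h2.trans h3.le)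

lemma Shortest.counter_le (hTM : ∀ x, TM x → x.2 < K) (hcard : Fintype.card M.Q < K)
    {p : M.Q} {m : ℕ} {v : List A} (hv : Shortest M TM (p, m) v) (hlen : v.length ≤ 7 * K ^ 3) :
    m ≤ 13 * K ^ 3 := by
  by_cases hm : m < 6 * K ^ 2
  · have : K ^ 2 ≤ K ^ 3 := Nat.pow_le_pow_right (by omega) (by norm_num)
    omega
  obtain ⟨pre, γ, post, k, δ, c, h1, h2, -, -, -, -, -, -, -, h3, -⟩ :=
    hv.exists_pump hTM hcard (not_lt.1 hm)
  have h4 := (abs_le.1 h3).1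
  have h5 : (δ : ℤ) * v.length ≤ δ * (7 * K ^ 3) :=
    mul_le_mul_of_nonneg_left (by exact_mod_cast hlen) (by positivity)
  have h6 : (δ : ℤ) * m ≤ γ.length * m :=
    mul_le_mul_of_nonneg_right (by exact_mod_cast h2) (by positivity)
  have h7 : (δ : ℤ) * m ≤ δ * (13 * K ^ 3) := by linarith
  have h8 := le_of_mul_le_mul_left h7 (by exact_mod_cast h1)
  exact_mod_cast h8

/-- Configurations with the same distance to the targets lie in a belt. -/
lemma exists_belt (hTM : ∀ x, TM x → x.2 < K) (hTN : ∀ x, TN x → x.2 < K)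
    (hK : Fintype.card M.Q + Fintype.card N.Q = K) {x : M.Q × ℕ} {y : N.Q × ℕ}
    {D : ℕ} (hD : Reach M TM D x) (heq : ∀ i ≤ D, (Reach M TM i x ↔ Reach N TN i y))
    (hbig : 13 * K ^ 3 < max x.2 y.2) :
    ∃ P R : ℤ, 1 ≤ P ∧ P ≤ Fintype.card M.Q * Fintype.card N.Q ∧ 1 ≤ R ∧
      R ≤ Fintype.card M.Q * Fintype.card N.Q ∧ Belt P R (12 * K ^ 3) x.2 y.2 := by
  obtain ⟨p, m⟩ := x
  obtain ⟨q, n⟩ := y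
  have hM0 : 0 < Fintype.card M.Q := Fintype.card_pos_iff.mpr ⟨p⟩
  have hN0 : 0 < Fintype.card N.Q := Fintype.card_pos_iff.mpr ⟨q⟩
  obtain ⟨v, hv, hvD⟩ := exists_shortest hD
  obtain ⟨u, hu, huv⟩ := exists_shortest ((heq _ hvD).1 ⟨v, le_rfl, hv.1⟩)
  obtain ⟨v', hv', hvu⟩ := exists_shortest ((heq _ (huv.trans hvD)).2 ⟨u, le_rfl, hu.1⟩)
  have hlen : u.length = v.length := by
    have := hv.2 v' hv'.1
    omega
  by_cases hm : m < 6 * K ^ 2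
  · have h1 := hv.length_le_of_low hTM (by omega) hm
    have h2 := hv.counter_le hTM (by omega) h1
    have h3 := hu.counter_le hTN (by omega) (by omega)
    have := max_le h2 h3
    simp only at hbig
    omega
  by_cases hn : n < 6 * K ^ 2
  · have h1 := hu.length_le_of_low hTN (by omega) hn
    have h2 := hu.counter_le hTN (by omega) h1
    have h3 := hv.counter_le hTM (by omega) (by omega)
    have := max_le h3 h2
    simp only at hbig
    omega
  obtain ⟨-, γ, -, -, δ, -, g1, g2, g3, -, -, -, -, -, -, g4, -⟩ :=
    hv.exists_pump hTM (by omega) (not_lt.1 hm)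
  obtain ⟨-, η, -, -, ε, -, k1, k2, k3, -, -, -, -, -, -, k4, -⟩ :=
    hu.exists_pump hTN (by omega) (not_lt.1 hn)
  rw [hlen] at k4
  refine ⟨(γ.length * ε : ℕ), (η.length * δ : ℕ), ?_, ?_, ?_, ?_, ?_⟩
  · exact_mod_cast Nat.mul_pos (by omega) (by omega)
  · exact_mod_cast Nat.mul_le_mul g3 (k2.trans k3)
  · exact_mod_cast Nat.mul_pos (by omega) (by omega)
  · rw [mul_comm (η.length)]
    exact_mod_cast Nat.mul_le_mul (g2.trans g3) k3
  · unfold Belt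
    have hmin : (δ : ℤ) * ε ≤ min ((γ.length * ε : ℕ) : ℤ) ((η.length * δ : ℕ) : ℤ) := by
      apply le_min
      · exact_mod_cast Nat.mul_le_mul_right ε g2
      · rw [mul_comm (η.length)]
        exact_mod_cast Nat.mul_le_mul_left δ k2
    have e : ((γ.length * ε : ℕ) : ℤ) * (m : ℤ) - ((η.length * δ : ℕ) : ℤ) * (n : ℤ) =
        δ * ((ε : ℤ) * v.length - η.length * n) - ε * ((δ : ℤ) * v.length - γ.length * m) := by
      push_cast
      ring
    have h1 : |(δ : ℤ) * ((ε : ℤ) * v.length - η.length * n)| ≤ δ * (ε * (6 * K ^ 3)) := by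
      rw [abs_mul, Nat.abs_cast]
      exact mul_le_mul_of_nonneg_left k4 (by positivity)
    have h2 : |(ε : ℤ) * ((δ : ℤ) * v.length - γ.length * m)| ≤ ε * (δ * (6 * K ^ 3)) := by
      rw [abs_mul, Nat.abs_cast]
      exact mul_le_mul_of_nonneg_left g4 (by positivity)
    have h3 := mul_le_mul_of_nonneg_left hmin (show (0 : ℤ) ≤ 12 * K ^ 3 by positivity)
    simp only
    rw [e]
    refine le_trans ?_ h3
    rw [abs_le] at h1 h2 ⊢
    constructor <;> linarith

end Distance

/-- A sequence climbing high has two times on its way up in the same class. -/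
lemma exists_climb {ι : Type} (c : ℕ → ι) (C : Finset ι) {X : ℕ → ℕ}
    (hX : ∀ i, X (i + 1) ≤ X i + 1) {t₀ j H Z : ℕ} (ht₀ : t₀ ≤ j) (h₀ : X t₀ = H)
    (hj : H + C.card * Z < X j) (hZ : 1 ≤ Z) (hC : ∀ t, t₀ ≤ t → t < j → c t ∈ C) :
    ∃ r s, t₀ ≤ r ∧ r < s ∧ s < j ∧ c r = c s ∧ X r + Z ≤ X s ∧ H ≤ X r ∧
      ∀ t, s ≤ t → t ≤ j → X s ≤ X t := by
  classical
  have hup : ∀ i, ∃ u, i ≤ C.card → t₀ ≤ u ∧ u < j ∧ X u = H + i * Z ∧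
      ∀ t, u < t → t ≤ j → H + i * Z < X t := by
    intro i
    by_cases hi : i ≤ C.card
    · have : i * Z ≤ C.card * Z := Nat.mul_le_mul_right _ hi
      obtain ⟨u, h⟩ := exists_last_up (g := X) (l := H + i * Z) hX t₀ ht₀ (by omega) (by omega)
      exact ⟨u, fun _ => h⟩
    · exact ⟨0, fun h => absurd h hi⟩
  choose u hu using hup
  obtain ⟨i, hi, i', hi', hne, hii⟩ := Finset.exists_ne_map_eq_of_card_lt_of_maps_to
    (s := Finset.range (C.card + 1)) (t := C) (by simp) (f := fun i => c (u i)) (by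
      intro i hi
      rw [Finset.coe_range, Set.mem_Iio] at hi
      obtain ⟨h1, h2, -⟩ := hu i (by omega)
      exact hC _ h1 h2)
  wlog hlt : i < i' generalizing i i'
  · exact this i' hi' i hi hne.symm hii.symm (lt_of_le_of_ne (not_lt.1 hlt) hne.symm)
  rw [Finset.mem_range] at hi hi'
  obtain ⟨a1, a2, a3, a4⟩ := hu i (by omega)
  obtain ⟨b1, b2, b3, b4⟩ := hu i' (by omega)
  have hZZ : i * Z + Z ≤ i' * Z := by
    have : (i + 1) * Z ≤ i' * Z := Nat.mul_le_mul_right _ hlt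
    rwa [Nat.add_mul, one_mul] at this
  refine ⟨u i, u i', a1, ?_, b2, hii, by omega, by omega, fun t ht htj => ?_⟩
  · rcases lt_trichotomy (u i) (u i') with h | h | h
    · exact h
    · rw [h] at a3
      omega
    · have := b4 _ h a2.le
      omega
  · rcases Nat.eq_or_lt_of_le ht with h | h
    · rw [h]
    · have := b4 t h htj
      omega

section Run

variable {A S : Type} [Field S]

/-- The part of the run of a minimal witness of length `L` up to a time `j`, before which the
distances of the two configurations to the targets are finite and equal. -/
structure EqualDistRun (M N : DWROCA A S) (TM : M.Q × ℕ → Prop) (TN : N.Q × ℕ → Prop)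
    (K L j : ℕ) (x₀ : M.Q × ℕ) (y₀ : N.Q × ℕ) (w : List A) : Prop where
  low_left : ∀ x, TM x → x.2 < K
  low_right : ∀ x, TN x → x.2 < K
  card_add : Fintype.card M.Q + Fintype.card N.Q = K
  init_left : x₀.2 = 0
  init_right : y₀.2 = 0
  le_length : j ≤ w.length
  reach_iff : ∀ i < j, ∀ n, Reach M TM n (crun M x₀ (w.take i)) ↔
    Reach N TN n (crun N y₀ (w.take i))
  finite : ∀ i < j, ∃ n, Reach M TM n (crun M x₀ (w.take i))
  minimal : ∀ (u : List A) (n : ℕ), u.length + K + n < L →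
    (Reach M TM n (crun M x₀ u) ↔ Reach N TN n (crun N y₀ u))

/-- The level above which the run stays inside one belt. -/
def baseLevel (K : ℕ) : ℕ := 4 * K ^ 7 + 4 * K ^ 6

variable {M N : DWROCA A S} {TM : M.Q × ℕ → Prop} {TN : N.Q × ℕ → Prop}
  {K L j : ℕ} {x₀ : M.Q × ℕ} {y₀ : N.Q × ℕ} {w : List A}

lemma EqualDistRun.numeric (E : EqualDistRun M N TM TN K L j x₀ y₀ w) :
    2 ≤ K ∧ (1 : ℤ) ≤ Fintype.card M.Q * Fintype.card N.Q ∧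
      (4 * (Fintype.card M.Q * Fintype.card N.Q) : ℤ) ≤ K ^ 2 ∧
      (16 * (Fintype.card M.Q * Fintype.card N.Q) ^ 2 : ℤ) ≤ K ^ 4 := by
  have h1 : 0 < Fintype.card M.Q := Fintype.card_pos_iff.mpr ⟨x₀.1⟩
  have h2 : 0 < Fintype.card N.Q := Fintype.card_pos_iff.mpr ⟨y₀.1⟩
  have hK : (K : ℤ) = Fintype.card M.Q + Fintype.card N.Q := by exact_mod_cast E.card_add.symm
  have h3 : (1 : ℤ) ≤ Fintype.card M.Q * Fintype.card N.Q := by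
    exact_mod_cast Nat.mul_pos h1 h2
  have h4 : (4 * (Fintype.card M.Q * Fintype.card N.Q) : ℤ) ≤ K ^ 2 := by
    rw [hK]
    nlinarith [sq_nonneg ((Fintype.card M.Q : ℤ) - Fintype.card N.Q)]
  refine ⟨by have := E.card_add; omega, h3, h4, ?_⟩
  calc (16 * (Fintype.card M.Q * Fintype.card N.Q) ^ 2 : ℤ)
      = (4 * (Fintype.card M.Q * Fintype.card N.Q)) ^ 2 := by ring
    _ ≤ (K ^ 2) ^ 2 := by gcongr
    _ = K ^ 4 := by ring

/-- Powers of an integer which is at least two. -/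
lemma pow_chain {k : ℤ} (hk : 2 ≤ k) :
    2 ≤ k ∧ 2 * k ≤ k ^ 2 ∧ 2 * k ^ 2 ≤ k ^ 3 ∧ 2 * k ^ 3 ≤ k ^ 4 ∧ 2 * k ^ 4 ≤ k ^ 5 ∧
      2 * k ^ 5 ≤ k ^ 6 ∧ 2 * k ^ 6 ≤ k ^ 7 := by
  have h : ∀ n : ℕ, 2 * k ^ n ≤ k ^ (n + 1) := fun n => by
    rw [pow_succ, mul_comm]
    exact mul_le_mul_of_nonneg_left hk (by positivity)
  exact ⟨hk, by simpa using h 1, h 2, h 3, h 4, h 5, h 6⟩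

lemma EqualDistRun.exists_belt_path (E : EqualDistRun M N TM TN K L j x₀ y₀ w)
    (hbig : 14 * K ^ 6 + 6 * K ^ 7 + 1 <
      max (crun M x₀ (w.take j)).2 (crun N y₀ (w.take j)).2) :
    ∃ (t₀ : ℕ) (P R : ℤ), t₀ < j ∧ 1 ≤ P ∧ P ≤ Fintype.card M.Q * Fintype.card N.Q ∧ 1 ≤ R ∧
      R ≤ Fintype.card M.Q * Fintype.card N.Q ∧
      (∀ t, t₀ ≤ t → t < j →
        Belt P R (12 * K ^ 3) (crun M x₀ (w.take t)).2 (crun N y₀ (w.take t)).2) ∧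
      ∀ (ι : Type) (c : ℕ → ι) (C : Finset ι) (Z : ℕ), 1 ≤ Z →
        C.card * Z ≤ 2 * K ^ 7 + 10 * K ^ 6 → (∀ t, t₀ ≤ t → t < j → c t ∈ C) →
        ∃ r s, t₀ ≤ r ∧ r < s ∧ s < j ∧ c r = c s ∧
          ((crun M x₀ (w.take r)).2 + Z ≤ (crun M x₀ (w.take s)).2 ∨
            (crun N y₀ (w.take r)).2 + Z ≤ (crun N y₀ (w.take s)).2) ∧
          ∀ t, s ≤ t → t ≤ j → (baseLevel K : ℤ) ≤
            max (((crun M x₀ (w.take t)).2 : ℤ) - (crun M x₀ (w.take s)).2 +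
                (crun M x₀ (w.take r)).2)
              (((crun N y₀ (w.take t)).2 : ℤ) - (crun N y₀ (w.take s)).2 +
                (crun N y₀ (w.take r)).2) := by
  obtain ⟨hK2, hT1, hT4, hT16⟩ := E.numeric
  set T : ℤ := Fintype.card M.Q * Fintype.card N.Q
  obtain ⟨-, c1, c2, c3, c4, c5, c6⟩ := pow_chain (k := K) (by exact_mod_cast hK2)
  set m : ℕ → ℕ := fun t => (crun M x₀ (w.take t)).2 with hm
  set n : ℕ → ℕ := fun t => (crun N y₀ (w.take t)).2 with hn
  have hHT : T ^ 2 * (12 * K ^ 3 + 12 * K ^ 3 + 2) < (baseLevel K : ℤ) := by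
    have : (16 * T ^ 2) * (12 * K ^ 3 + 12 * K ^ 3 + 2) ≤
        (K : ℤ) ^ 4 * (12 * K ^ 3 + 12 * K ^ 3 + 2) :=
      mul_le_mul_of_nonneg_right hT16 (by positivity)
    have e : (K : ℤ) ^ 4 * (12 * K ^ 3 + 12 * K ^ 3 + 2) = 24 * K ^ 7 + 2 * K ^ 4 := by ring
    simp only [baseLevel]
    push_cast
    linarith
  have hH13 : 13 * K ^ 3 < baseLevel K := by
    zify
    simp only [baseLevel]
    push_cast
    linarith
  obtain ⟨X, hX, hX0, hXmax, hXj, hXs, hXt⟩ : ∃ X : ℕ → ℕ, (∀ i, X (i + 1) ≤ X i + 1) ∧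
      X 0 = 0 ∧ (∀ t, X t ≤ max (m t) (n t)) ∧ 14 * K ^ 6 + 6 * K ^ 7 + 1 < X j ∧
      (∀ r s Z, X r + Z ≤ X s → m r + Z ≤ m s ∨ n r + Z ≤ n s) ∧
      (∀ r s t, (X t : ℤ) - X s + X r ≤
        max ((m t : ℤ) - m s + m r) ((n t : ℤ) - n s + n r)) := by
    rcases lt_max_iff.1 hbig with hb | hb
    · exact ⟨m, fun i => (crun_take_succ_snd M x₀ w i).1, by simp [hm, crun, E.init_left],
        fun t => le_max_left _ _, hb, fun _ _ _ h => Or.inl h, fun _ _ _ => le_max_left _ _⟩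
    · exact ⟨n, fun i => (crun_take_succ_snd N y₀ w i).1, by simp [hn, crun, E.init_right],
        fun t => le_max_right _ _, hb, fun _ _ _ h => Or.inr h, fun _ _ _ => le_max_right _ _⟩
  obtain ⟨t₀, -, ht₀j, ht₀, habove⟩ := exists_last_up (g := X) (l := baseLevel K) (t := j) hX 0
    (Nat.zero_le _) (by omega) (by simp only [baseLevel]; omega)
  have hhigh : ∀ t, t₀ ≤ t → t ≤ j → baseLevel K ≤ max (m t) (n t) := by
    intro t h1 h2
    refine le_trans ?_ (hXmax t)
    rcases Nat.eq_or_lt_of_le h1 with h | h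
    · rw [← h, ht₀]
    · exact (habove t h h2).le
  have hbelt : ∀ t, t₀ ≤ t → t < j → ∃ P R : ℤ, 1 ≤ P ∧ P ≤ T ∧ 1 ≤ R ∧ R ≤ T ∧
      Belt P R (12 * K ^ 3) (m t) (n t) := by
    intro t h1 h2
    obtain ⟨D, hD⟩ := E.finite t h2
    exact exists_belt E.low_left E.low_right E.card_add hD
      (fun i _ => E.reach_iff t h2 i) (lt_of_lt_of_le hH13 (hhigh t h1 h2.le))
  obtain ⟨P, R, hP, hPT, hR, hRT, hPR⟩ := hbelt t₀ le_rfl ht₀j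
  refine ⟨t₀, P, R, ht₀j, hP, hPT, hR, hRT, ?_, ?_⟩
  · intro t ht
    induction t, ht using Nat.le_induction with
    | base => exact fun _ => hPR
    | succ t ht ih =>
      intro htj
      obtain ⟨P', R', hP', hPT', hR', hRT', hPR'⟩ := hbelt (t + 1) (by omega) htj
      have hb : (baseLevel K : ℤ) ≤ max (m (t + 1) : ℤ) (n (t + 1)) := by
        exact_mod_cast hhigh (t + 1) (by omega) htj.le
      have s1 := crun_take_succ_snd M x₀ w t
      have s2 := crun_take_succ_snd N y₀ w t
      exact Belt.transfer hP hPT hR hRT hP' hPT' hR' hRT' (by positivity) (by positivity)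
        (ih (by omega)) hPR' (abs_le.2 ⟨by omega, by omega⟩) (abs_le.2 ⟨by omega, by omega⟩)
        (lt_of_lt_of_le hHT hb)
  · intro ι c C Z hZ hCZ hC
    obtain ⟨r, s, h1, h2, h3, h4, h5, h6, h7⟩ := exists_climb c C hX ht₀j.le ht₀
      (by simp only [baseLevel]; omega) hZ hC
    refine ⟨r, s, h1, h2, h3, h4, hXs r s Z h5, fun t ht htj => ?_⟩
    refine le_trans ?_ (hXt r s t)
    have := h7 t ht htj
    omega

/-- The word `u` leads to the same states as the first `j` letters of `w`, with counter values
that are smaller by `a` and `b` but still large, close to the belt. -/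
structure ShortCut (M N : DWROCA A S) (K j : ℕ) (x₀ : M.Q × ℕ) (y₀ : N.Q × ℕ) (w : List A)
    (P R : ℤ) (a b : ℕ) (u : List A) (m' n' : ℕ) : Prop where
  length_lt : u.length < j
  left : crun M x₀ u = ((crun M x₀ (w.take j)).1, m')
  right : crun N y₀ u = ((crun N y₀ (w.take j)).1, n')
  left_add : m' + a = (crun M x₀ (w.take j)).2
  right_add : n' + b = (crun N y₀ (w.take j)).2
  left_ge : 9 * K ^ 2 ≤ m'
  right_ge : 9 * K ^ 2 ≤ n'
  base_le : (baseLevel K : ℤ) ≤ max (m' : ℤ) n'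
  near_belt : ∃ m₁ n₁ : ℤ, |m₁ - m'| ≤ 1 ∧ |n₁ - n'| ≤ 1 ∧ Belt P R (3 * (12 * K ^ 3)) m₁ n₁

/-- Cutting out a part of the run along which both counters grow. -/
lemma EqualDistRun.exists_cut (E : EqualDistRun M N TM TN K L j x₀ y₀ w) {t₀ r s a b : ℕ}
    {P R : ℤ} (hP : 1 ≤ P) (hPT : P ≤ Fintype.card M.Q * Fintype.card N.Q) (hR : 1 ≤ R)
    (hRT : R ≤ Fintype.card M.Q * Fintype.card N.Q)
    (hbelt : ∀ t, t₀ ≤ t → t < j →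
      Belt P R (12 * K ^ 3) (crun M x₀ (w.take t)).2 (crun N y₀ (w.take t)).2)
    (hr : t₀ ≤ r) (hrs : r < s) (hsj : s < j)
    (hp : (crun M x₀ (w.take r)).1 = (crun M x₀ (w.take s)).1)
    (hq : (crun N y₀ (w.take r)).1 = (crun N y₀ (w.take s)).1)
    (ha : (crun M x₀ (w.take r)).2 + a = (crun M x₀ (w.take s)).2)
    (hb : (crun N y₀ (w.take r)).2 + b = (crun N y₀ (w.take s)).2)
    (hhigh : ∀ t, s ≤ t → t ≤ j → (baseLevel K : ℤ) ≤
      max (((crun M x₀ (w.take t)).2 : ℤ) - (crun M x₀ (w.take s)).2 +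
          (crun M x₀ (w.take r)).2)
        (((crun N y₀ (w.take t)).2 : ℤ) - (crun N y₀ (w.take s)).2 +
          (crun N y₀ (w.take r)).2)) :
    ∃ (u : List A) (m' n' : ℕ), ShortCut M N K j x₀ y₀ w P R a b u m' n' := by
  obtain ⟨hK2, hT1, hT4, hT16⟩ := E.numeric
  set T : ℤ := Fintype.card M.Q * Fintype.card N.Q
  obtain ⟨c0, c1, c2, c3, c4, c5, c6⟩ := pow_chain (k := K) (by exact_mod_cast hK2)
  have hlow : ∀ P R m n : ℤ, 1 ≤ P → P ≤ T → 1 ≤ R → R ≤ T →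
      Belt P R (3 * (12 * K ^ 3)) m n → (baseLevel K : ℤ) ≤ max m n → 9 * K ^ 2 + 1 ≤ m := by
    intro P R m n hP hPT hR hRT h hmax
    have h1 := h.lower hP hPT hR (by positivity) (by positivity) hmax
    have h2 : (baseLevel K : ℤ) ≤ baseLevel K * min P R :=
      le_mul_of_one_le_right (by positivity) (le_min hP hR)
    have h3 : T * (64 * T * (K ^ 3 + K ^ 2)) ≤ baseLevel K := by
      have : (16 * T ^ 2) * (4 * (K ^ 3 + K ^ 2)) ≤ (K : ℤ) ^ 4 * (4 * (K ^ 3 + K ^ 2)) :=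
        mul_le_mul_of_nonneg_right hT16 (by positivity)
      simp only [baseLevel]
      push_cast
      linarith
    have h4 : 64 * T * (K ^ 3 + K ^ 2) ≤ m + 3 * (12 * K ^ 3) :=
      le_of_mul_le_mul_left (h3.trans (h2.trans h1)) (by linarith)
    have h5 : (64 * (K ^ 3 + K ^ 2) : ℤ) ≤ 64 * T * (K ^ 3 + K ^ 2) :=
      mul_le_mul_of_nonneg_right (by linarith) (by positivity)
    linarith
  have hcomb : ∀ t, s ≤ t → t < j → Belt P R (3 * (12 * K ^ 3))
      (((crun M x₀ (w.take t)).2 : ℤ) - (crun M x₀ (w.take s)).2 + (crun M x₀ (w.take r)).2)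
      (((crun N y₀ (w.take t)).2 : ℤ) - (crun N y₀ (w.take s)).2 + (crun N y₀ (w.take r)).2) :=
    fun t h1 h2 => (hbelt t (by omega) h2).comb (hbelt s (by omega) hsj)
      (hbelt r hr (by omega))
  have hlowM : ∀ t, s ≤ t → t < j → 9 * K ^ 2 + 1 + a ≤ (crun M x₀ (w.take t)).2 := by
    intro t h1 h2
    have := hlow P R _ _ hP hPT hR hRT (hcomb t h1 h2) (hhigh t h1 h2.le)
    zify at ha ⊢
    linarith
  have hlowN : ∀ t, s ≤ t → t < j → 9 * K ^ 2 + 1 + b ≤ (crun N y₀ (w.take t)).2 := by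
    intro t h1 h2
    have := hlow R P _ _ hR hRT hP hPT (hcomb t h1 h2).swap
      (by rw [max_comm]; exact hhigh t h1 h2.le)
    zify at hb ⊢
    linarith
  obtain ⟨a1, a2⟩ := crun_cut M x₀ w a hsj.le hp ha fun t h1 h2 => by
    have := hlowM t h1 h2
    omega
  obtain ⟨b1, b2⟩ := crun_cut N y₀ w b hsj.le hq hb fun t h1 h2 => by
    have := hlowN t h1 h2
    omega
  have hjw := E.le_length
  have s1 := crun_take_succ_snd M x₀ w (j - 1)
  have s2 := crun_take_succ_snd N y₀ w (j - 1)
  rw [Nat.sub_add_cancel (by omega)] at s1 s2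
  have l1 := hlowM (j - 1) (by omega) (by omega)
  have l2 := hlowN (j - 1) (by omega) (by omega)
  refine ⟨w.take r ++ (w.drop s).take (j - s),
    (crun M x₀ (w.take r ++ (w.drop s).take (j - s))).2,
    (crun N y₀ (w.take r ++ (w.drop s).take (j - s))).2, ?_, Prod.ext a1 rfl, Prod.ext b1 rfl, a2,
    b2, by omega, by omega, ?_, _, _, ?_, ?_, hcomb (j - 1) (by omega) (by omega)⟩
  · simp only [List.length_append, List.length_take, List.length_drop]
    omega
  · have := hhigh j hsj.le le_rfl
    convert this using 2 <;> omega
  · rw [abs_le]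
    omega
  · rw [abs_le]
    omega

end Run

section Run

variable {A S : Type} [Field S] {M N : DWROCA A S} {TM : M.Q × ℕ → Prop} {TN : N.Q × ℕ → Prop}
  {K L j : ℕ} {x₀ : M.Q × ℕ} {y₀ : N.Q × ℕ} {w : List A}

/-- The class of a counter pair relative to a vector parallel to the belt. -/
lemma Belt.mem_Icc {P R F : ℤ} {a₀ b₀ m n : ℕ} (hP : 1 ≤ P) (hR : 1 ≤ R) (hF : 0 ≤ F)
    (ha₀ : 1 ≤ a₀) (hPR : P * a₀ = R * b₀) (h : Belt P R F m n) :
    (n : ℤ) - b₀ * ((m / a₀ : ℕ) : ℤ) ∈ Finset.Icc (-F) (F + b₀) := by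
  unfold Belt at h
  have h1 : F * min P R ≤ F * R := mul_le_mul_of_nonneg_left (min_le_right _ _) hF
  have h2 : ((m % a₀ : ℕ) : ℤ) + a₀ * ((m / a₀ : ℕ) : ℤ) = m := by
    exact_mod_cast Nat.mod_add_div m a₀
  have h3 : P * ((m % a₀ : ℕ) : ℤ) ≤ P * a₀ :=
    mul_le_mul_of_nonneg_left (by exact_mod_cast (Nat.mod_lt m ha₀).le) (by linarith)
  have h4 : 0 ≤ P * ((m % a₀ : ℕ) : ℤ) := by positivity
  have e : R * ((n : ℤ) - b₀ * ((m / a₀ : ℕ) : ℤ)) =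
      -(P * m - R * n) + P * ((m % a₀ : ℕ) : ℤ) := by
    linear_combination (-P) * h2 + ((m / a₀ : ℕ) : ℤ) * hPR
  rw [abs_le] at h
  rw [Finset.mem_Icc]
  constructor
  · refine le_of_mul_le_mul_left (a := R) ?_ (by linarith)
    rw [e]
    linarith
  · refine le_of_mul_le_mul_left (a := R) ?_ (by linarith)
    rw [e]
    linarith

lemma EqualDistRun.exists_shortcuts (E : EqualDistRun M N TM TN K L j x₀ y₀ w)
    (hbig : 14 * K ^ 6 + 6 * K ^ 7 + 1 <
      max (crun M x₀ (w.take j)).2 (crun N y₀ (w.take j)).2) :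
    ∃ P R : ℤ, 1 ≤ P ∧ P ≤ Fintype.card M.Q * Fintype.card N.Q ∧ 1 ≤ R ∧
      R ≤ Fintype.card M.Q * Fintype.card N.Q ∧
      (∀ δ : ℕ, 1 ≤ δ → δ ≤ Fintype.card M.Q → ∃ (a b : ℕ) (u : List A) (m' n' : ℕ),
        0 < a ∧ δ ∣ a ∧ ShortCut M N K j x₀ y₀ w P R a b u m' n') ∧
      ∀ a₀ b₀ : ℕ, 1 ≤ a₀ → a₀ ≤ Fintype.card M.Q * Fintype.card N.Q →
        b₀ ≤ Fintype.card M.Q * Fintype.card N.Q → P * a₀ = R * b₀ →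
        ∃ (τ : ℕ) (u : List A) (m' n' : ℕ), 0 < τ ∧
          ShortCut M N K j x₀ y₀ w P R (τ * a₀) (τ * b₀) u m' n' := by
  classical
  obtain ⟨hK2, hT1, hT4, hT16⟩ := E.numeric
  obtain ⟨c0, c1, c2, c3, c4, c5, c6⟩ := pow_chain (k := K) (by exact_mod_cast hK2)
  obtain ⟨t₀, P, R, ht₀, hP, hPT, hR, hRT, hbelt, hclimb⟩ := E.exists_belt_path hbig
  refine ⟨P, R, hP, hPT, hR, hRT, fun δ hδ hδM => ?_, fun a₀ b₀ ha₀ haT hbT hPR => ?_⟩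
  · obtain ⟨r, s, hr, hrs, hsj, hc, hor, hhigh⟩ := hclimb (M.Q × N.Q × ℕ)
      (fun t => ((crun M x₀ (w.take t)).1, (crun N y₀ (w.take t)).1,
        (crun M x₀ (w.take t)).2 % δ))
      (Finset.univ ×ˢ Finset.univ ×ˢ Finset.range δ) (2 * (12 * K ^ 3) + 1) (by omega) (by
        rw [Finset.card_product, Finset.card_product, Finset.card_univ, Finset.card_univ,
          Finset.card_range, ← mul_assoc]
        zify
        have h1 : (δ : ℤ) ≤ K := by
          have := E.card_add
          exact_mod_cast (show δ ≤ K by omega)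
        have h2 : (4 * (Fintype.card M.Q * Fintype.card N.Q) : ℤ) * δ *
            (2 * (12 * K ^ 3) + 1) ≤ K ^ 2 * K * (2 * (12 * K ^ 3) + 1) := by gcongr
        have h3 : (K : ℤ) ^ 2 * K * (2 * (12 * K ^ 3) + 1) = 24 * K ^ 6 + K ^ 3 := by ring
        linarith) (by
        intro t _ _
        simpa using Nat.mod_lt _ hδ)
    simp only [Prod.mk.injEq] at hc
    obtain ⟨hp, hq, hmod⟩ := hc
    have hF : (0 : ℤ) ≤ 12 * K ^ 3 := by positivity
    have hbr := hbelt r hr (by omega)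
    have hbs := hbelt s (by omega) hsj
    have hinc : (crun M x₀ (w.take r)).2 < (crun M x₀ (w.take s)).2 ∧
        (crun N y₀ (w.take r)).2 < (crun N y₀ (w.take s)).2 := by
      rcases hor with h | h
      · refine ⟨by omega, ?_⟩
        have := Belt.increase hP hR hF hbr.swap hbs.swap (by exact_mod_cast h)
        exact_mod_cast this
      · refine ⟨?_, by omega⟩
        have := Belt.increase hR hP hF hbr hbs (by exact_mod_cast h)
        exact_mod_cast this
    obtain ⟨u, m', n', hu⟩ := E.exists_cut hP hPT hR hRT hbelt hr hrs hsj hp hq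
      (Nat.add_sub_cancel' hinc.1.le) (Nat.add_sub_cancel' hinc.2.le) hhigh
    exact ⟨_, _, u, m', n', Nat.sub_pos_of_lt hinc.1, (Nat.modEq_iff_dvd' hinc.1.le).1 hmod, hu⟩
  · obtain ⟨r, s, hr, hrs, hsj, hc, hor, hhigh⟩ := hclimb (M.Q × N.Q × ℕ × ℤ)
      (fun t => ((crun M x₀ (w.take t)).1, (crun N y₀ (w.take t)).1,
        (crun M x₀ (w.take t)).2 % a₀,
        ((crun N y₀ (w.take t)).2 : ℤ) - b₀ * (((crun M x₀ (w.take t)).2 / a₀ : ℕ) : ℤ)))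
      (Finset.univ ×ˢ Finset.univ ×ˢ Finset.range a₀ ×ˢ
        Finset.Icc (-(12 * K ^ 3 : ℤ)) (12 * K ^ 3 + b₀)) 1 le_rfl (by
        rw [Finset.card_product, Finset.card_product, Finset.card_product, Finset.card_univ,
          Finset.card_univ, Finset.card_range, Int.card_Icc, mul_one, ← mul_assoc]
        have e : (12 * (K : ℤ) ^ 3 + b₀ + 1 - -(12 * K ^ 3)).toNat = 24 * K ^ 3 + b₀ + 1 := by
          zify
          rw [Int.toNat_of_nonneg (by rw [sub_neg_eq_add]; positivity)]
          ring
        rw [e]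
        zify
        zify at haT hbT
        set T : ℤ := Fintype.card M.Q * Fintype.card N.Q
        have hb' : (b₀ : ℤ) ≤ K ^ 2 := by linarith
        have h1 : T * (a₀ * (24 * K ^ 3 + b₀ + 1)) ≤ T * (T * (24 * K ^ 3 + K ^ 2 + 1)) := by
          gcongr
        have h2 : (16 * T ^ 2) * (24 * K ^ 3 + K ^ 2 + 1) ≤
            (K : ℤ) ^ 4 * (24 * K ^ 3 + K ^ 2 + 1) :=
          mul_le_mul_of_nonneg_right hT16 (by positivity)
        linarith) (by
        intro t h1 h2
        simp only [Finset.mem_product, Finset.mem_univ, true_and]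
        refine ⟨Finset.mem_range.2 (Nat.mod_lt _ ha₀), ?_⟩
        exact (hbelt t h1 h2).mem_Icc hP hR (by positivity) ha₀ hPR)
    simp only [Prod.mk.injEq] at hc
    obtain ⟨hp, hq, hmod, hcl⟩ := hc
    set mr := (crun M x₀ (w.take r)).2 with hmr
    set ms := (crun M x₀ (w.take s)).2 with hms
    set nr := (crun N y₀ (w.take r)).2 with hnr
    set ns := (crun N y₀ (w.take s)).2 with hns
    have e1 := Nat.mod_add_div mr a₀
    have e2 := Nat.mod_add_div ms a₀
    have hτ : mr / a₀ < ms / a₀ := by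
      by_contra hcon
      have h1 : a₀ * (ms / a₀) ≤ a₀ * (mr / a₀) := Nat.mul_le_mul_left _ (not_lt.1 hcon)
      have h2 : (b₀ : ℤ) * ((ms / a₀ : ℕ) : ℤ) ≤ b₀ * ((mr / a₀ : ℕ) : ℤ) :=
        mul_le_mul_of_nonneg_left (by exact_mod_cast not_lt.1 hcon) (by positivity)
      rcases hor with h | h
      · omega
      · zify at h
        linarith
    obtain ⟨τ, hτe⟩ := Nat.exists_eq_add_of_lt hτ
    obtain ⟨u, m', n', hu⟩ := E.exists_cut (a := (τ + 1) * a₀) (b := (τ + 1) * b₀)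
      hP hPT hR hRT hbelt hr hrs hsj hp hq
      (by
        rw [← hmr, ← hms, ← e1, ← e2, hmod, hτe]
        ring)
      (by
        rw [← hnr, ← hns]
        rw [hτe] at hcl
        push_cast at hcl
        zify
        linarith) hhigh
    exact ⟨τ + 1, u, m', n', by omega, hu⟩

/-- A run that gets high can be shortened keeping the states. -/
lemma EqualDistRun.exists_copy (E : EqualDistRun M N TM TN K L j x₀ y₀ w)
    (hbig : 14 * K ^ 6 + 6 * K ^ 7 + 1 <
      max (crun M x₀ (w.take j)).2 (crun N y₀ (w.take j)).2) :
    ∃ u : List A, u.length < j ∧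
      (crun M x₀ u).1 = (crun M x₀ (w.take j)).1 ∧
      (crun N y₀ u).1 = (crun N y₀ (w.take j)).1 ∧
      K ≤ (crun M x₀ u).2 ∧ K ≤ (crun N y₀ u).2 ∧
      K ≤ (crun M x₀ (w.take j)).2 ∧ K ≤ (crun N y₀ (w.take j)).2 := by
  obtain ⟨P, R, -, -, -, -, h, -⟩ := E.exists_shortcuts hbig
  obtain ⟨a, b, u, m', n', -, -, hu⟩ := h 1 le_rfl (Fintype.card_pos_iff.mpr ⟨x₀.1⟩)
  have hK : K ≤ 9 * K ^ 2 := by nlinarith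
  have h1 := hu.left_ge
  have h2 := hu.right_ge
  have h3 := hu.left_add
  have h4 := hu.right_add
  refine ⟨u, hu.length_lt, ?_, ?_, ?_, ?_, by omega, by omega⟩
  · rw [hu.left]
  · rw [hu.right]
  · rw [hu.left]
    exact hK.trans h1
  · rw [hu.right]
    exact hK.trans h2

end Run

/-- Iterating a word makes the state periodic. -/
lemma exists_period {Q A : Type} [Fintype Q] (nx : Q → A → Q) (q : Q) (γ : List A) :
    ∃ e, 1 ≤ e ∧ e ≤ Fintype.card Q ∧
      state nx (state nx q (rep γ (Fintype.card Q))) (rep γ e) =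
        state nx q (rep γ (Fintype.card Q)) := by
  classical
  obtain ⟨i, hi, i', hi', hne, hii⟩ := Finset.exists_ne_map_eq_of_card_lt_of_maps_to
    (s := Finset.range (Fintype.card Q + 1)) (t := Finset.univ) (by simp)
    (f := fun i => state nx q (rep γ i)) (fun _ _ => Finset.mem_univ _)
  wlog hlt : i < i' generalizing i i'
  · exact this i' hi' i hi hne.symm hii.symm (lt_of_le_of_ne (not_lt.1 hlt) hne.symm)
  rw [Finset.mem_range] at hi hi'
  refine ⟨i' - i, by omega, by omega, ?_⟩
  rw [← state_append, ← rep_add,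
    show Fintype.card Q + (i' - i) = i' + (Fintype.card Q - i) by omega, rep_add, state_append,
    ← hii, ← state_append, ← rep_add, Nat.add_sub_cancel' (by omega)]

section Run

variable {A S : Type} [Field S] {M N : DWROCA A S} {TM : M.Q × ℕ → Prop} {TN : N.Q × ℕ → Prop}
  {K L j : ℕ} {x₀ : M.Q × ℕ} {y₀ : N.Q × ℕ} {w : List A}

lemma EqualDistRun.reach_iff_of_shortCut (E : EqualDistRun M N TM TN K L j x₀ y₀ w) {P R : ℤ}
    {a b m' n' : ℕ} {u : List A} (hu : ShortCut M N K j x₀ y₀ w P R a b u m' n') {d : ℕ}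
    (hL : j + K + d ≤ L) {v : List A} {n : ℕ} (hn : v.length + n ≤ d) :
    Reach M TM n (crun M ((crun M x₀ (w.take j)).1, m') v) ↔
      Reach N TN n (crun N ((crun N y₀ (w.take j)).1, n') v) := by
  rw [← hu.left, ← hu.right, ← crun_append, ← crun_append]
  refine E.minimal _ _ ?_
  have := hu.length_lt
  rw [List.length_append]
  omega

/-- A run to the target from the end of a shortcut stays inside the belt for a while. -/
lemma EqualDistRun.belt_of_shortCut (E : EqualDistRun M N TM TN K L j x₀ y₀ w) {P R : ℤ}
    {a b m' n' : ℕ} {u : List A} (hu : ShortCut M N K j x₀ y₀ w P R a b u m' n')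
    (hP : 1 ≤ P) (hPT : P ≤ Fintype.card M.Q * Fintype.card N.Q) (hR : 1 ≤ R)
    (hRT : R ≤ Fintype.card M.Q * Fintype.card N.Q) {d : ℕ}
    (hL : j + K + d ≤ L) {v : List A} (hv : v.length ≤ d)
    (hTv : TM (crun M ((crun M x₀ (w.take j)).1, m') v)) {B : ℕ}
    (hB : ((Fintype.card M.Q * Fintype.card N.Q : ℤ)) ^ 2 * (24 * K ^ 3 + 2) + B < baseLevel K) :
    ∀ i ≤ B, i ≤ v.length → Belt P R (12 * K ^ 3)
      (crun M ((crun M x₀ (w.take j)).1, m') (v.take i)).2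
      (crun N ((crun N y₀ (w.take j)).1, n') (v.take i)).2 := by
  obtain ⟨hK2, hT1, hT4, hT16⟩ := E.numeric
  obtain ⟨c0, c1, c2, c3, c4, c5, c6⟩ := pow_chain (k := K) (by exact_mod_cast hK2)
  have hbl := hu.base_le
  set p := (crun M x₀ (w.take j)).1
  set q := (crun N y₀ (w.take j)).1
  have hT2 : (24 * K ^ 3 + 2 : ℤ) ≤
      (Fintype.card M.Q * Fintype.card N.Q : ℤ) ^ 2 * (24 * K ^ 3 + 2) :=
    le_mul_of_one_le_left (by positivity) (by nlinarith)
  have hlarge : ∀ i ≤ B, (baseLevel K : ℤ) ≤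
      max ((crun M (p, m') (v.take i)).2 : ℤ) (crun N (q, n') (v.take i)).2 + B := by
    intro i hi
    have h1 := le_crun_snd M (p, m') (v.take i)
    have h2 := le_crun_snd N (q, n') (v.take i)
    have h3 : (v.take i).length ≤ i := by simp
    simp only at h1 h2
    omega
  have hbelt : ∀ i ≤ B, i ≤ v.length → ∃ P R : ℤ, 1 ≤ P ∧
      P ≤ Fintype.card M.Q * Fintype.card N.Q ∧ 1 ≤ R ∧
      R ≤ Fintype.card M.Q * Fintype.card N.Q ∧ Belt P R (12 * K ^ 3)
        (crun M (p, m') (v.take i)).2 (crun N (q, n') (v.take i)).2 := by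
    intro i hi hiv
    refine exists_belt E.low_left E.low_right E.card_add (D := v.length - i)
      ⟨v.drop i, by simp, by rwa [← crun_take_drop]⟩ (fun n hn => ?_) ?_
    · refine E.reach_iff_of_shortCut hu hL ?_
      rw [List.length_take]
      omega
    · have := hlarge i hi
      zify
      linarith
  intro i
  induction i with
  | zero =>
    intro h1 h2
    obtain ⟨P', R', hP', hPT', hR', hRT', hPR'⟩ := hbelt 0 h1 h2
    obtain ⟨m₁, n₁, hm₁, hn₁, hb⟩ := hu.near_belt
    simp only [List.take_zero, crun_nil] at hPR' ⊢
    refine hb.transfer hP hPT hR hRT hP' hPT' hR' hRT' (by positivity) (by positivity) hPR'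
      hm₁ hn₁ (lt_of_lt_of_le ?_ hbl)
    set T : ℤ := Fintype.card M.Q * Fintype.card N.Q
    have : (16 * T ^ 2) * (3 * (12 * K ^ 3) + 12 * K ^ 3 + 2) ≤
        (K : ℤ) ^ 4 * (3 * (12 * K ^ 3) + 12 * K ^ 3 + 2) :=
      mul_le_mul_of_nonneg_right hT16 (by positivity)
    simp only [baseLevel]
    push_cast
    linarith
  | succ i ih =>
    intro h1 h2
    obtain ⟨P', R', hP', hPT', hR', hRT', hPR'⟩ := hbelt (i + 1) h1 h2
    have s1 := crun_take_succ_snd M (p, m') v i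
    have s2 := crun_take_succ_snd N (q, n') v i
    have := hlarge (i + 1) h1
    exact Belt.transfer hP hPT hR hRT hP' hPT' hR' hRT' (by positivity) (by positivity)
      (ih (by omega) (by omega)) hPR' (abs_le.2 ⟨by omega, by omega⟩)
      (abs_le.2 ⟨by omega, by omega⟩) (by linarith)

/-- A longer pumping phase compensates for a larger initial counter value. -/
lemma crun_pump_eq {q : N.Q} {pre γ post : List A} {e c₀ τ n' k : ℕ}
    (he : state (hnext N) (state (hnext N) q (pre ++ rep γ (Fintype.card N.Q))) (rep γ e) =
      state (hnext N) q (pre ++ rep γ (Fintype.card N.Q)))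
    (hc₀ : effect (hnext N) (hupd N) (state (hnext N) q (pre ++ rep γ (Fintype.card N.Q)))
      (rep γ e) = -c₀)
    (hn' : (pre ++ rep γ (Fintype.card N.Q)).length + (rep γ e).length ≤ n')
    (hk : Fintype.card N.Q ≤ k) :
    crun N (q, n' + τ * c₀) (pre ++ (rep γ (k + τ * e) ++ post)) =
      crun N (q, n') (pre ++ (rep γ k ++ post)) := by
  obtain ⟨l, rfl⟩ := Nat.exists_eq_add_of_le hk
  set pre' := pre ++ rep γ (Fintype.card N.Q) with hpre'
  have e1 : pre ++ (rep γ (Fintype.card N.Q + l + τ * e) ++ post) =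
      pre' ++ (rep (rep γ e) τ ++ (rep γ l ++ post)) := by
    rw [hpre', ← rep_mul, show Fintype.card N.Q + l + τ * e = Fintype.card N.Q + (e * τ + l) by
      ring, rep_add, rep_add]
    simp only [List.append_assoc]
  have e2 : pre ++ (rep γ (Fintype.card N.Q + l) ++ post) = pre' ++ (rep γ l ++ post) := by
    rw [hpre', rep_add]
    simp only [List.append_assoc]
  obtain ⟨a1, a2⟩ := crun_eq_of_le N q n' pre' (by omega)
  obtain ⟨b1, b2⟩ := crun_eq_of_le N q (n' + τ * c₀) pre' (by omega)
  have heff := abs_le.1 (abs_effect_le (hnext N) (abs_hupd_le N) q pre')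
  rw [e1, e2, crun_append, crun_append N _ pre', crun_append]
  congr 1
  have h1 : crun N (q, n') pre' = (state (hnext N) q pre', (crun N (q, n') pre').2) :=
    Prod.ext a1 rfl
  have h2 : crun N (q, n' + τ * c₀) pre' =
      (state (hnext N) q pre', (crun N (q, n') pre').2 + τ * c₀) := by
    refine Prod.ext b1 ?_
    zify
    push_cast at b2
    rw [b2, a2]
    ring
  rw [h2, crun_rep he hc₀ (by omega)]
  exact h1.symm

/-- Far from the origin, both coordinates of a point in a belt are large. -/
lemma Belt.lt_of_base {P R T x y : ℤ} {μ : ℤ} (hP : 1 ≤ P) (hPT : P ≤ T) (hR : 1 ≤ R)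
    (hμ : min P R = μ) (hT1 : 1 ≤ T) (hT4 : 4 * T ≤ K ^ 2) (hT16 : 16 * T ^ 2 ≤ K ^ 4)
    (hK2 : 2 ≤ K) (hmax : (baseLevel K : ℤ) ≤ max x y) (h : Belt P R (12 * K ^ 3) x y) :
    6 * K ^ 2 + T + (24 * K ^ 3 * (T * μ) + T) < x := by
  obtain ⟨c0, c1, c2, c3, c4, c5, c6⟩ := pow_chain (k := K) (by exact_mod_cast hK2)
  have hμ1 : 1 ≤ μ := by
    rw [← hμ]
    exact le_min hP hR
  have hTμ1 : 1 ≤ T * μ := one_le_mul_of_one_le_of_one_le hT1 hμ1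
  have h1 := h.lower hP hPT hR (by positivity) (by positivity) hmax
  rw [hμ] at h1
  have h2 : (T * (64 * T * (K ^ 3 + K ^ 2)) : ℤ) ≤ baseLevel K := by
    have : (16 * T ^ 2) * (4 * (K ^ 3 + K ^ 2)) ≤ (K : ℤ) ^ 4 * (4 * (K ^ 3 + K ^ 2)) :=
      mul_le_mul_of_nonneg_right hT16 (by positivity)
    simp only [baseLevel]
    push_cast
    linarith
  have h3 : (T * (64 * (T * μ) * (K ^ 3 + K ^ 2)) : ℤ) ≤ T * (x + 12 * K ^ 3) := by
    calc (T * (64 * (T * μ) * (K ^ 3 + K ^ 2)) : ℤ)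
        = T * (64 * T * (K ^ 3 + K ^ 2)) * μ := by ring
      _ ≤ baseLevel K * μ := mul_le_mul_of_nonneg_right h2 (by linarith)
      _ ≤ _ := h1
  have h4 := le_of_mul_le_mul_left h3 (by linarith)
  have h5 : (K ^ 3 : ℤ) ≤ T * μ * K ^ 3 := le_mul_of_one_le_left (by positivity) hTμ1
  have h6 : (K ^ 2 : ℤ) ≤ T * μ * K ^ 2 := le_mul_of_one_le_left (by positivity) hTμ1
  linarith

/-- The effects of a cycle pumped after a shortcut are parallel to the belt. -/
lemma EqualDistRun.parallel_of_shortCut (E : EqualDistRun M N TM TN K L j x₀ y₀ w) {P R β : ℤ}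
    {a b m' n' : ℕ} {u : List A} (hu : ShortCut M N K j x₀ y₀ w P R a b u m' n')
    (hP : 1 ≤ P) (hPT : P ≤ Fintype.card M.Q * Fintype.card N.Q) (hR : 1 ≤ R)
    (hRT : R ≤ Fintype.card M.Q * Fintype.card N.Q) {d : ℕ} (hL : j + K + d ≤ L)
    {p : M.Q} {q : N.Q} (hp : p = (crun M x₀ (w.take j)).1) (hq : q = (crun N y₀ (w.take j)).1)
    {pre γ post : List A} {e δ k' : ℕ} (he2 : e ≤ Fintype.card N.Q) (hδγ : δ ≤ γ.length)
    (hγ : γ.length ≤ Fintype.card M.Q) (hpre : pre.length ≤ 2 * K ^ 2)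
    (hγs : state (hnext M) (state (hnext M) p pre) γ = state (hnext M) p pre)
    (hγe : effect (hnext M) (hupd M) (state (hnext M) p pre) γ = -δ)
    (hes : state (hnext N) (state (hnext N) q (pre ++ rep γ (Fintype.card N.Q))) (rep γ e) =
      state (hnext N) q (pre ++ rep γ (Fintype.card N.Q)))
    (hβ : effect (hnext N) (hupd N) (state (hnext N) q (pre ++ rep γ (Fintype.card N.Q)))
      (rep γ e) = -β)
    (hk' : m' ≤ k' * δ + 6 * K ^ 2) (htm : TM (crun M (p, m') (pre ++ (rep γ k' ++ post))))
    (hvl : (pre ++ (rep γ k' ++ post)).length ≤ d) : P * (e * δ : ℕ) = R * β := by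
  by_contra hpar
  obtain ⟨hK2, hT1, hT4, hT16⟩ := E.numeric
  obtain ⟨c0, c1, c2, c3, c4, c5, c6⟩ := pow_chain (k := K) (by exact_mod_cast hK2)
  set pre' := pre ++ rep γ (Fintype.card N.Q) with hpre'
  have hgT : Fintype.card N.Q * γ.length ≤ Fintype.card M.Q * Fintype.card N.Q := by
    rw [mul_comm]
    exact Nat.mul_le_mul_right _ hγ
  have heT : e * γ.length ≤ Fintype.card M.Q * Fintype.card N.Q :=
    (Nat.mul_le_mul_right _ he2).trans hgT
  have hδT : e * δ ≤ Fintype.card M.Q * Fintype.card N.Q :=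
    (Nat.mul_le_mul_left _ hδγ).trans heT
  have hδT' : Fintype.card N.Q * δ ≤ Fintype.card M.Q * Fintype.card N.Q :=
    (Nat.mul_le_mul_left _ hδγ).trans hgT
  have hpl : pre'.length ≤ 2 * K ^ 2 + Fintype.card M.Q * Fintype.card N.Q := by
    rw [hpre', List.length_append, length_rep]
    omega
  obtain ⟨μ, hμ⟩ := Int.eq_ofNat_of_zero_le (show 0 ≤ min P R from le_min (by linarith)
    (by linarith))
  have hμ1 : (1 : ℤ) ≤ μ := by
    rw [← hμ]
    exact le_min hP hR
  have hμT : (μ : ℤ) ≤ Fintype.card M.Q * Fintype.card N.Q := by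
    rw [← hμ]
    exact (min_le_left _ _).trans hPT
  set I : ℕ := 24 * K ^ 3 * μ + 1 with hI
  have hBle : pre'.length + I * (rep γ e).length ≤
      2 * K ^ 2 + Fintype.card M.Q * Fintype.card N.Q +
        I * (Fintype.card M.Q * Fintype.card N.Q) := by
    rw [length_rep]
    exact Nat.add_le_add hpl (Nat.mul_le_mul_left _ heT)
  have hkle : (Fintype.card N.Q + e * I) * δ ≤ Fintype.card M.Q * Fintype.card N.Q +
      I * (Fintype.card M.Q * Fintype.card N.Q) := by
    calc (Fintype.card N.Q + e * I) * δ = Fintype.card N.Q * δ + I * (e * δ) := by ring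
      _ ≤ _ := Nat.add_le_add hδT' (Nat.mul_le_mul_left _ hδT)
  set B := pre'.length + I * (rep γ e).length with hBdef
  set T : ℕ := Fintype.card M.Q * Fintype.card N.Q with hTdef
  have hTc : (Fintype.card M.Q * Fintype.card N.Q : ℤ) = T := by rw [hTdef]; push_cast; rfl
  rw [hTc] at hT1 hT4 hT16 hPT hRT hμT
  have hIT : ((I * T : ℕ) : ℤ) = 24 * K ^ 3 * (T * μ) + T := by
    rw [hI]
    push_cast
    ring
  have hIT' : (I : ℤ) * T = 24 * K ^ 3 * (T * μ) + T := by exact_mod_cast hIT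
  have hTμ : (T * μ : ℤ) ≤ T ^ 2 := by
    rw [sq]
    exact mul_le_mul_of_nonneg_left hμT (by positivity)
  have hTμ1 : (1 : ℤ) ≤ T * μ := one_le_mul_of_one_le_of_one_le hT1 hμ1
  have hB : ((Fintype.card M.Q * Fintype.card N.Q : ℤ)) ^ 2 * (24 * K ^ 3 + 2) + B <
      baseLevel K := by
    have h1 : (24 * K ^ 3 * (T * μ) : ℤ) ≤ 24 * K ^ 3 * T ^ 2 :=
      mul_le_mul_of_nonneg_left hTμ (by positivity)
    have h2 : (16 * T ^ 2 : ℤ) * (48 * K ^ 3 + 2) ≤ K ^ 4 * (48 * K ^ 3 + 2) :=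
      mul_le_mul_of_nonneg_right hT16 (by positivity)
    rw [hTc]
    zify at hBle
    push_cast at hIT
    simp only [baseLevel]
    push_cast
    linarith
  have hbelt := E.belt_of_shortCut hu hP (by rwa [hTc]) hR (by rwa [hTc]) hL hvl (hp ▸ htm) hB
  have hb0 := hbelt 0 (Nat.zero_le _) (Nat.zero_le _)
  simp only [List.take_zero, crun_nil] at hb0
  have hlm := hb0.lt_of_base hP hPT hR hμ hT1 hT4 hT16 hK2 hu.base_le
  have hln := hb0.swap.lt_of_base hR hRT hP ((min_comm _ _).trans hμ) hT1 hT4 hT16 hK2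
    (by rw [max_comm]; exact hu.base_le)
  rw [← hIT'] at hlm hln
  have hlm' : 6 * K ^ 2 + T + I * T < m' := by exact_mod_cast hlm
  have hln' : 6 * K ^ 2 + T + I * T < n' := by exact_mod_cast hln
  have hkk : Fintype.card N.Q + e * I ≤ k' := by
    by_contra hcon
    have : k' * δ ≤ (Fintype.card N.Q + e * I) * δ := Nat.mul_le_mul_right _ (by omega)
    omega
  obtain ⟨z, rfl⟩ := Nat.exists_eq_add_of_le hkk
  have hv' : pre ++ (rep γ (Fintype.card N.Q + e * I + z) ++ post) =
      pre' ++ (rep (rep γ e) I ++ (rep γ z ++ post)) := by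
    rw [hpre', ← rep_mul, rep_add, rep_add]
    simp only [List.append_assoc]
  rw [hv'] at hbelt
  have hstart := hbelt pre'.length (Nat.le_add_right _ _) (by simp)
  have hend := hbelt B le_rfl (by
    simp only [List.length_append, length_rep, hBdef]
    omega)
  rw [List.take_left] at hstart
  rw [← List.append_assoc, List.take_left' (by rw [List.length_append, length_rep _ I])] at hend
  rw [← hp, ← hq] at hstart hend
  rw [(crun_eq_of_le M p m' pre' (by omega)).2, (crun_eq_of_le N q n' pre' (by omega)).2]
    at hstart
  have hpM : state (hnext M) p pre' = state (hnext M) p pre := by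
    rw [hpre', state_append, state_rep hγs]
  rw [(crun_eq_of_le M p m' _ (by rw [List.length_append, length_rep _ I]; omega)).2,
    (crun_eq_of_le N q n' _ (by rw [List.length_append, length_rep _ I]; omega)).2,
    effect_append _ _ p pre', effect_append _ _ q pre', effect_rep _ hes, hβ, hpM,
    ← rep_mul, effect_rep _ hγs, hγe] at hend
  unfold Belt at hstart hend
  rw [hμ] at hstart hend
  have hD : P * (e * δ : ℕ) - R * β ≠ 0 := sub_ne_zero.2 hpar
  have hID : |(I : ℤ) * (P * (e * δ : ℕ) - R * β)| < I := by
    have e1 : (I : ℤ) = 24 * K ^ 3 * μ + 1 := by rw [hI]; push_cast; rfl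
    rw [abs_le] at hstart hend
    push_cast at hend ⊢
    rw [abs_lt]
    constructor <;> linarith
  rw [abs_mul, Nat.abs_cast] at hID
  have : (I : ℤ) * 1 ≤ I * |P * (e * δ : ℕ) - R * β| :=
    mul_le_mul_of_nonneg_left (Int.one_le_abs hD) (by positivity)
  linarith

/-- The distances to the targets cannot differ after a run that gets high. -/
theorem EqualDistRun.reach_right (E : EqualDistRun M N TM TN K L j x₀ y₀ w)
    (hbig : 14 * K ^ 6 + 6 * K ^ 7 + 1 <
      max (crun M x₀ (w.take j)).2 (crun N y₀ (w.take j)).2) {d : ℕ} (hL : j + K + d ≤ L)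
    (hd : Reach M TM d (crun M x₀ (w.take j))) : Reach N TN d (crun N y₀ (w.take j)) := by
  obtain ⟨hK2, hT1, hT4, hT16⟩ := E.numeric
  obtain ⟨c0, c1, c2, c3, c4, c5, c6⟩ := pow_chain (k := K) (by exact_mod_cast hK2)
  obtain ⟨P, R, hP, hPT, hR, hRT, hcut, hcutpar⟩ := E.exists_shortcuts hbig
  have hn1 : 0 < Fintype.card M.Q := Fintype.card_pos_iff.mpr ⟨x₀.1⟩
  have hn2 : 0 < Fintype.card N.Q := Fintype.card_pos_iff.mpr ⟨y₀.1⟩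
  obtain ⟨v, hv, hvd⟩ := exists_shortest hd
  set p := (crun M x₀ (w.take j)).1 with hp
  set m := (crun M x₀ (w.take j)).2 with hm
  set q := (crun N y₀ (w.take j)).1 with hq
  set n := (crun N y₀ (w.take j)).2 with hn
  have hm6 : 6 * K ^ 2 ≤ m := by
    obtain ⟨a, b, u, m', n', -, -, hu⟩ := hcut 1 le_rfl hn1
    have h1 := hu.left_ge
    have h2 := hu.left_add
    omega
  obtain ⟨pre, γ, post, k, δ, c, hδ, hδγ, hγ, hpre, hγs, hγe, hmc, htgt, hlen, -, hmk⟩ :=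
    Shortest.exists_pump (p := p) (m := m) E.low_left (by have := E.card_add; omega) hv hm6
  have hT : 4 * (Fintype.card M.Q * Fintype.card N.Q) ≤ K ^ 2 := by exact_mod_cast hT4
  have hshort : ∀ {l b : ℕ} {u : List A} {m' n' : ℕ},
      ShortCut M N K j x₀ y₀ w P R (l * δ) b u m' n' →
      ∃ k', k = k' + l ∧ m' ≤ k' * δ + 6 * K ^ 2 ∧
        TM (crun M (p, m') (pre ++ (rep γ k' ++ post))) ∧
        (pre ++ (rep γ k' ++ post)).length ≤ d := by
    intro l b u m' n' hu
    have h1 := hu.left_add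
    have h2 := hu.left_ge
    rw [← hm] at h1
    have hlk : l ≤ k := by
      by_contra hcon
      have : k * δ ≤ l * δ := Nat.mul_le_mul_right _ (by omega)
      have : 0 < K ^ 2 := by positivity
      omega
    obtain ⟨k', rfl⟩ := Nat.exists_eq_add_of_le' hlk
    refine ⟨k', rfl, ?_, htgt m' k' ?_, ?_⟩
    · rw [Nat.add_mul] at hmk
      omega
    · push_cast at hmc
      have : (m : ℤ) = m' + l * δ := by exact_mod_cast h1.symm
      linarith
    · rw [Nat.add_mul] at hlen
      simp only [List.length_append, length_rep]
      omega
  obtain ⟨e, he1, he2, hes⟩ := exists_period (hnext N) (state (hnext N) q pre) γ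
  rw [← state_append (hnext N) q pre] at hes
  set pre' := pre ++ rep γ (Fintype.card N.Q) with hpre'
  have hgT : Fintype.card N.Q * γ.length ≤ Fintype.card M.Q * Fintype.card N.Q := by
    rw [mul_comm]
    exact Nat.mul_le_mul_right _ hγ
  have heT : e * γ.length ≤ Fintype.card M.Q * Fintype.card N.Q :=
    (Nat.mul_le_mul_right _ he2).trans hgT
  have hδT : e * δ ≤ Fintype.card M.Q * Fintype.card N.Q :=
    (Nat.mul_le_mul_left _ hδγ).trans heT
  have hδT' : Fintype.card N.Q * δ ≤ Fintype.card M.Q * Fintype.card N.Q :=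
    (Nat.mul_le_mul_left _ hδγ).trans hgT
  have hpl : pre'.length ≤ 2 * K ^ 2 + Fintype.card M.Q * Fintype.card N.Q := by
    rw [hpre', List.length_append, length_rep]
    omega
  obtain ⟨β, hβ⟩ : ∃ β : ℤ, effect (hnext N) (hupd N) (state (hnext N) q pre') (rep γ e) = -β :=
    ⟨_, (neg_neg _).symm⟩
  have hβT : |β| ≤ (e * γ.length : ℕ) := by
    have := abs_effect_le (hnext N) (abs_hupd_le N) (state (hnext N) q pre') (rep γ e)
    rwa [hβ, abs_neg, length_rep] at this
  have heδ : 1 ≤ e * δ := Nat.mul_pos he1 hδ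
  by_cases hpar : P * (e * δ : ℕ) = R * β
  · have hβ0 : 0 ≤ β := by
      have : 0 < R * β := by
        rw [← hpar]
        positivity
      exact ((mul_pos_iff_of_pos_left (by linarith)).1 this).le
    obtain ⟨b₀, rfl⟩ := Int.eq_ofNat_of_zero_le hβ0
    obtain ⟨τ, u, m', n', hτ, hu⟩ := hcutpar (e * δ) b₀ heδ hδT
      (le_trans (by rw [Nat.abs_cast] at hβT; exact_mod_cast hβT) heT) hpar
    rw [← mul_assoc] at hu
    obtain ⟨k', rfl, hk', htm, hvl⟩ := hshort hu
    have hm' := hu.left_ge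
    have hn' := hu.right_ge
    have hk2 : Fintype.card N.Q ≤ k' := by
      by_contra hcon
      have : k' * δ ≤ Fintype.card N.Q * δ := Nat.mul_le_mul_right _ (by omega)
      have : 0 < K ^ 2 := by positivity
      omega
    have hrn := (E.reach_iff_of_shortCut hu hL (n := 0) hvl).1 ⟨[], le_rfl, htm⟩
    obtain ⟨v', hv', htn⟩ := hrn
    rw [List.length_eq_zero_iff.1 (Nat.le_zero.1 hv'), crun_nil, ← hq,
      ← crun_pump_eq (τ := τ) hes hβ (by rw [← hpre', length_rep]; omega) hk2] at htn
    refine ⟨pre ++ (rep γ (k' + τ * e) ++ post), ?_, ?_⟩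
    · simp only [List.length_append, length_rep]
      omega
    · rwa [hu.right_add, ← hn] at htn
  · exfalso
    obtain ⟨a, b, u, m', n', ha, ⟨l, rfl⟩, hu⟩ := hcut δ hδ (hδγ.trans hγ)
    rw [mul_comm] at hu
    obtain ⟨k', rfl, hk', htm, hvl⟩ := hshort hu
    exact hpar (E.parallel_of_shortCut hu hP hPT hR hRT hL hp hq he2 hδγ hγ hpre hγs hγe hes hβ
      hk' htm hvl)

end Run

section Weight

variable {Z A S : Type} [Field S] (st : Z → A → Z) (out : Z → A → S)

/-- The product of the outputs of a deterministic machine along a word. -/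
def weight : Z → List A → S
  | _, [] => 1
  | z, a :: w => out z a * weight (st z a) w

@[simp] lemma weight_nil (z : Z) : weight st out z [] = 1 := rfl

@[simp] lemma weight_cons (z : Z) (a : A) (w : List A) :
    weight st out z (a :: w) = out z a * weight st out (st z a) w := rfl

lemma weight_append (z : Z) (v w : List A) :
    weight st out z (v ++ w) = weight st out z v * weight st out (state st z v) w := by
  induction v generalizing z with
  | nil => simp [state]
  | cons a v ih => simp [ih, state, mul_assoc]

/-- Two states have the same outputs on all words of length at most `k`. -/
def Eqv (k : ℕ) (z z' : Z) : Prop :=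
  ∀ w : List A, w.length ≤ k → weight st out z w = weight st out z' w

variable {st out}

lemma Eqv.symm {k : ℕ} {z z' : Z} (h : Eqv st out k z z') : Eqv st out k z' z :=
  fun w hw => (h w hw).symm

lemma Eqv.trans {k : ℕ} {z₁ z₂ z₃ : Z} (h : Eqv st out k z₁ z₂) (h' : Eqv st out k z₂ z₃) :
    Eqv st out k z₁ z₃ := fun w hw => (h w hw).trans (h' w hw)

lemma Eqv.mono {k l : ℕ} {z z' : Z} (h : Eqv st out l z z') (hkl : k ≤ l) : Eqv st out k z z' :=
  fun w hw => h w (hw.trans hkl)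

lemma weight_ne_zero (hout : ∀ z a, out z a ≠ 0) (z : Z) (w : List A) : weight st out z w ≠ 0 := by
  induction w generalizing z with
  | nil => simp
  | cons a w ih => simp [hout, ih]

lemma Eqv.run (hout : ∀ z a, out z a ≠ 0)
    {k : ℕ} {z z' : Z} {v : List A} (h : Eqv st out (v.length + k) z z') :
    Eqv st out k (state st z v) (state st z' v) := by
  intro w hw
  have h1 := h (v ++ w) (by rw [List.length_append]; omega)
  rw [weight_append, weight_append, h v (by omega)] at h1
  exact mul_left_cancel₀ (weight_ne_zero hout _ _) h1

lemma eqv_succ (hout : ∀ z a, out z a ≠ 0)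
    {k : ℕ} {z z' : Z} : Eqv st out (k + 1) z z' ↔
    ∀ a, out z a = out z' a ∧ Eqv st out k (st z a) (st z' a) := by
  constructor
  · intro h a
    refine ⟨by simpa using h [a] (by simp), ?_⟩
    exact Eqv.run hout (v := [a]) (h.mono (by simp [add_comm]))
  · intro h w hw
    cases w with
    | nil => simp
    | cons a w =>
      rw [List.length_cons] at hw
      simp [(h a).1, (h a).2 w (by omega)]

variable {U : Finset Z}

lemma Eqv.of_stable (hout : ∀ z a, out z a ≠ 0) (hU : ∀ u ∈ U, ∀ a, st u a ∈ U)
    {i : ℕ}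
    (h : ∀ u ∈ U, ∀ u' ∈ U, Eqv st out i u u' → Eqv st out (i + 1) u u') {u u' : Z}
    (hu : u ∈ U) (hu' : u' ∈ U) (huu : Eqv st out i u u') (l : ℕ) : Eqv st out (i + l) u u' := by
  induction l generalizing u u' with
  | zero => exact huu
  | succ l ih =>
    rw [← add_assoc, eqv_succ hout]
    intro a
    obtain ⟨h1, h2⟩ := (eqv_succ hout).1 (h u hu u' hu' huu) a
    exact ⟨h1, ih (hU u hu a) (hU u' hu' a) h2⟩

/-- Equivalence up to the number of states is full equivalence. -/
lemma Eqv.of_card (hout : ∀ z a, out z a ≠ 0) (hU : ∀ u ∈ U, ∀ a, st u a ∈ U)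
    {k : ℕ} (hk : U.card ≤ k + 1) {u u' : Z} (hu : u ∈ U) (hu' : u' ∈ U)
    (huu : Eqv st out k u u') (l : ℕ) : Eqv st out l u u' := by
  classical
  set g : ℕ → Z → Finset Z := fun k u => U.filter (Eqv st out k u) with hg
  have hgeq : ∀ k, ∀ u ∈ U, ∀ u' ∈ U, Eqv st out k u u' ↔ g k u = g k u' := by
    intro k u _ u' hu'
    constructor
    · intro h
      exact Finset.filter_congr fun z _ => ⟨fun h' => h.symm.trans h', fun h' => h.trans h'⟩
    · intro h
      have : u' ∈ g k u' := Finset.mem_filter.2 ⟨hu', fun _ _ => rfl⟩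
      rw [← h] at this
      exact (Finset.mem_filter.1 this).2
  set c : ℕ → ℕ := fun k => (U.image (g k)).card with hc
  have hgrow : ∀ k, (∃ i < k, ∀ u ∈ U, ∀ u' ∈ U, Eqv st out i u u' → Eqv st out (i + 1) u u') ∨
      k + 1 ≤ c k := by
    intro k
    induction k with
    | zero => exact Or.inr (Finset.card_pos.2 (Finset.image_nonempty.2 ⟨u, hu⟩))
    | succ k ih =>
      rcases ih with ⟨i, hi, h⟩ | h
      · exact Or.inl ⟨i, by omega, h⟩
      have himg : U.image (g k) = (U.image (g (k + 1))).image
          fun C => U.filter fun z => ∃ x ∈ C, Eqv st out k x z := by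
        rw [Finset.image_image]
        refine Finset.image_congr fun v hv => ?_
        refine Finset.filter_congr fun z _ => ⟨fun h' => ?_, ?_⟩
        · exact ⟨v, Finset.mem_filter.2 ⟨hv, fun _ _ => rfl⟩, h'⟩
        · rintro ⟨x, hx, hxz⟩
          exact ((Finset.mem_filter.1 hx).2.mono (Nat.le_succ k)).trans hxz
      have hle : c k ≤ c (k + 1) := by
        simp only [hc]
        rw [himg]
        exact Finset.card_image_le
      rcases Nat.eq_or_lt_of_le hle with heq | hlt
      · refine Or.inl ⟨k, by omega, fun v hv v' hv' hvv => ?_⟩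
        have hinj := Finset.card_image_iff.1 (by rw [← himg]; exact heq)
        rw [hgeq _ v hv v' hv']
        refine hinj (Finset.mem_coe.2 (Finset.mem_image_of_mem _ hv))
          (Finset.mem_coe.2 (Finset.mem_image_of_mem _ hv')) ?_
        refine Finset.filter_congr fun z _ => ⟨?_, ?_⟩
        · rintro ⟨x, hx, hxz⟩
          exact ⟨v', Finset.mem_filter.2 ⟨hv', fun _ _ => rfl⟩, hvv.symm.trans
            (((Finset.mem_filter.1 hx).2.mono (Nat.le_succ k)).trans hxz)⟩
        · rintro ⟨x, hx, hxz⟩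
          exact ⟨v, Finset.mem_filter.2 ⟨hv, fun _ _ => rfl⟩, hvv.trans
            (((Finset.mem_filter.1 hx).2.mono (Nat.le_succ k)).trans hxz)⟩
      · exact Or.inr (by omega)
  rcases hgrow U.card with ⟨i, hi, h⟩ | h
  · exact (Eqv.of_stable hout hU h hu hu' (huu.mono (by omega)) l).mono (by omega)
  · have : c U.card ≤ U.card := Finset.card_image_le
    omega

variable (st out U) in
/-- The state is not equivalent, up to length `K`, to a state of `U`. -/
def FarFrom (K : ℕ) (z : Z) : Prop := ∀ u ∈ U, ¬ Eqv st out K z u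

lemma Eqv.step (hout : ∀ z a, out z a ≠ 0) (hU : ∀ u ∈ U, ∀ a, st u a ∈ U)
    {K : ℕ} (hK : U.card ≤ K) (hK0 : 0 < K) {z z' : Z} {a : A}
    (h : Eqv st out K z z') (hz : ¬ FarFrom st out U K z)
    (hza : ¬ FarFrom st out U K (st z a)) (hza' : ¬ FarFrom st out U K (st z' a)) :
    Eqv st out K (st z a) (st z' a) := by
  obtain ⟨k, rfl⟩ := Nat.exists_eq_succ_of_ne_zero hK0.ne'
  have key : ∀ z, ∀ u ∈ U, Eqv st out (k + 1) z u → ¬ FarFrom st out U (k + 1) (st z a) →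
      Eqv st out (k + 1) (st z a) (st u a) := by
    intro z u hu hzu hfar
    unfold FarFrom at hfar
    push Not at hfar
    obtain ⟨u₂, hu₂, h₂⟩ := hfar
    have h3 := ((eqv_succ hout).1 hzu a).2
    exact h₂.trans (Eqv.of_card hout hU hK hu₂ (hU u hu a)
      ((h₂.mono (Nat.le_succ k)).symm.trans h3) _)
  unfold FarFrom at hz
  push Not at hz
  obtain ⟨u, hu, hzu⟩ := hz
  exact (key z u hu hzu hza).trans (key z' u hu (h.symm.trans hzu) hza').symm

/-- Equivalence up to length `K` persists as long as states equivalent to `U` are visited. -/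
lemma Eqv.extend (hout : ∀ z a, out z a ≠ 0) (hU : ∀ u ∈ U, ∀ a, st u a ∈ U)
    {K : ℕ} (hK : U.card ≤ K) (hK0 : 0 < K) (e : ℕ) {z z' : Z}
    (h : Eqv st out K z z')
    (hz : ∀ v : List A, v.length ≤ e → ¬ FarFrom st out U K (state st z v))
    (hz' : ∀ v : List A, v.length ≤ e → ¬ FarFrom st out U K (state st z' v)) :
    Eqv st out (K + e) z z' := by
  induction e generalizing z z' with
  | zero => exact h
  | succ e ih =>
    rw [← add_assoc, eqv_succ hout]
    intro a
    refine ⟨by simpa using h [a] hK0, ih ?_ ?_ ?_⟩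
    · exact h.step hout hU hK hK0 (hz [] (by simp)) (hz [a] (by simp)) (hz' [a] (by simp))
    · exact fun v hv => hz (a :: v) (by simpa using hv)
    · exact fun v hv => hz' (a :: v) (by simpa using hv)

/-- Equivalence transfers runs to the target set. -/
lemma Eqv.exists_farFrom (hout : ∀ z a, out z a ≠ 0)
    {K n : ℕ} {z z' : Z} (h : Eqv st out (n + K) z z')
    (hz : ∃ v : List A, v.length ≤ n ∧ FarFrom st out U K (state st z v)) :
    ∃ v : List A, v.length ≤ n ∧ FarFrom st out U K (state st z' v) := by
  obtain ⟨v, hv, hfar⟩ := hz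
  exact ⟨v, hv, fun u hu hzu =>
    hfar u hu ((Eqv.run hout (h.mono (by omega))).trans hzu)⟩

end Weight

section Product

variable {A S : Type} [Field S]

/-- The configurations, without weights, of two dwROCAs and of their underlying weighted
automata. -/
abbrev Conf (M N : DWROCA A S) : Type := ((M.Q × ℕ) ⊕ (N.Q × ℕ)) ⊕ (M.Q ⊕ N.Q)

/-- The transitions between configurations. -/
def confStep (M N : DWROCA A S) : Conf M N → A → Conf M N
  | .inl (.inl x), a => .inl (.inl (cstep M x a))
  | .inl (.inr y), a => .inl (.inr (cstep N y a))
  | .inr (.inl p), a => .inr (.inl (hnext M p a))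
  | .inr (.inr q), a => .inr (.inr (hnext N q a))

/-- The weights of the transitions between configurations. -/
def confOut (M N : DWROCA A S) : Conf M N → A → S
  | .inl (.inl x), a => M.wt x.1 (decide (x.2 = 0)) a
  | .inl (.inr y), a => N.wt y.1 (decide (y.2 = 0)) a
  | .inr (.inl p), a => M.wt p false a
  | .inr (.inr q), a => N.wt q false a

/-- The configurations of the underlying weighted automata. -/
def counterFree (M N : DWROCA A S) : Finset (Conf M N) :=
  Finset.univ.map ⟨Sum.inr, Sum.inr_injective⟩

variable (M N : DWROCA A S)

lemma card_counterFree : (counterFree M N).card = Fintype.card M.Q + Fintype.card N.Q := by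
  rw [counterFree, Finset.card_map, Finset.card_univ, Fintype.card_sum]

lemma confStep_mem_counterFree : ∀ u ∈ counterFree M N, ∀ a,
    confStep M N u a ∈ counterFree M N := by
  rintro (u | u | u) hu a
  · simp [counterFree] at hu
  · simp [counterFree, confStep]
  · simp [counterFree, confStep]

lemma confOut_ne_zero (z : Conf M N) (a : A) : confOut M N z a ≠ 0 := by
  rcases z with (z | z) | (z | z)
  · exact M.wt_ne _ _ _
  · exact N.wt_ne _ _ _
  · exact M.wt_ne _ _ _
  · exact N.wt_ne _ _ _

/-- The weight of a word from a configuration. -/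
abbrev confWeight : Conf M N → List A → S := weight (confStep M N) (confOut M N)

/-- Equivalence of configurations on words of bounded length. -/
abbrev confEqv : ℕ → Conf M N → Conf M N → Prop := Eqv (confStep M N) (confOut M N)

/-- Configurations that are not equivalent to a configuration without counter. -/
abbrev confFar : ℕ → Conf M N → Prop := FarFrom (confStep M N) (confOut M N) (counterFree M N)

lemma state_left (x : M.Q × ℕ) (w : List A) :
    state (confStep M N) (.inl (.inl x)) w = .inl (.inl (crun M x w)) := by
  induction w generalizing x with
  | nil => rfl
  | cons a w ih => exact ih _

lemma state_right (y : N.Q × ℕ) (w : List A) :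
    state (confStep M N) (.inl (.inr y)) w = .inl (.inr (crun N y w)) := by
  induction w generalizing y with
  | nil => rfl
  | cons a w ih => exact ih _

lemma run_left (q : M.Q) (n : ℕ) (s : S) (w : List A) :
    M.run (q, n, s) w = ((crun M (q, n) w).1, (crun M (q, n) w).2,
      s * confWeight M N (.inl (.inl (q, n))) w) := by
  induction w generalizing q n s with
  | nil => simp [DWROCA.run]
  | cons a w ih =>
    have h := ih (M.next q (decide (n = 0)) a) (((n : ℤ) + M.upd q (decide (n = 0)) a).toNat)
      (s * M.wt q (decide (n = 0)) a)
    rw [mul_assoc] at h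
    exact h

lemma run_right (q : N.Q) (n : ℕ) (s : S) (w : List A) :
    N.run (q, n, s) w = ((crun N (q, n) w).1, (crun N (q, n) w).2,
      s * confWeight M N (.inl (.inr (q, n))) w) := by
  induction w generalizing q n s with
  | nil => simp [DWROCA.run]
  | cons a w ih =>
    have h := ih (N.next q (decide (n = 0)) a) (((n : ℤ) + N.upd q (decide (n = 0)) a).toNat)
      (s * N.wt q (decide (n = 0)) a)
    rw [mul_assoc] at h
    exact h

lemma uval_left (q : M.Q) (s : S) (w : List A) :
    M.uval (q, s) w = s * confWeight M N (.inr (.inl q)) w := by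
  induction w generalizing q s with
  | nil => simp [DWROCA.uval]
  | cons a w ih =>
    have h := ih (M.next q false a) (s * M.wt q false a)
    rw [mul_assoc] at h
    exact h

lemma uval_right (q : N.Q) (s : S) (w : List A) :
    N.uval (q, s) w = s * confWeight M N (.inr (.inr q)) w := by
  induction w generalizing q s with
  | nil => simp [DWROCA.uval]
  | cons a w ih =>
    have h := ih (N.next q false a) (s * N.wt q false a)
    rw [mul_assoc] at h
    exact h

lemma confWeight_left_of_le (q : M.Q) (n : ℕ) (w : List A) (h : w.length ≤ n) :
    confWeight M N (.inl (.inl (q, n))) w = confWeight M N (.inr (.inl q)) w := by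
  induction w generalizing q n with
  | nil => rfl
  | cons a w ih =>
    rw [List.length_cons] at h
    have hn : decide (n = 0) = false := by simp; omega
    have h1 := le_cstep_snd M (q, n) a
    have h2 := ih (cstep M (q, n) a).1 (cstep M (q, n) a).2 (by simp only at h1; omega)
    have h3 : (cstep M (q, n) a).1 = hnext M q a := by
      rw [cstep_of_pos M (by omega)]
    rw [h3] at h2
    simp only [confWeight, weight_cons, confOut, confStep, hn] at h2 ⊢
    rw [← h2, ← h3]

lemma confWeight_right_of_le (q : N.Q) (n : ℕ) (w : List A) (h : w.length ≤ n) :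
    confWeight M N (.inl (.inr (q, n))) w = confWeight M N (.inr (.inr q)) w := by
  induction w generalizing q n with
  | nil => rfl
  | cons a w ih =>
    rw [List.length_cons] at h
    have hn : decide (n = 0) = false := by simp; omega
    have h1 := le_cstep_snd N (q, n) a
    have h2 := ih (cstep N (q, n) a).1 (cstep N (q, n) a).2 (by simp only at h1; omega)
    have h3 : (cstep N (q, n) a).1 = hnext N q a := by
      rw [cstep_of_pos N (by omega)]
    rw [h3] at h2
    simp only [confWeight, weight_cons, confOut, confStep, hn] at h2 ⊢
    rw [← h2, ← h3]

variable {M N}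

lemma scaled_eq_iff {Z : Type} {st : Z → A → Z} {out : Z → A → S} {z z' : Z} {s s' : S}
    (hs : s ≠ 0) (k : ℕ) :
    (∀ w : List A, w.length ≤ k → s * weight st out z w = s' * weight st out z' w) ↔
      s = s' ∧ Eqv st out k z z' := by
  constructor
  · intro h
    have h0 : s = s' := by simpa using h [] (Nat.zero_le _)
    subst h0
    exact ⟨rfl, fun w hw => mul_left_cancel₀ hs (h w hw)⟩
  · rintro ⟨rfl, h⟩ w hw
    rw [h w hw]

lemma kEquiv_iff {p : M.Q} {q : N.Q} {m n k : ℕ} {s s' : S} (hs : s ≠ 0) :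
    kEquiv M N (p, m, s) (q, n, s') k ↔
      s = s' ∧ confEqv M N k (.inl (.inl (p, m))) (.inl (.inr (q, n))) := by
  rw [← scaled_eq_iff hs]
  unfold kEquiv DWROCA.val
  simp only [run_left M N, run_right M N]

lemma confFar_iff {k : ℕ} {z : Conf M N} : confFar M N k z ↔
    (∀ p, ¬ confEqv M N k z (.inr (.inl p))) ∧ ∀ q, ¬ confEqv M N k z (.inr (.inr q)) := by
  simp [confFar, FarFrom, counterFree]

lemma inNWA_left {p : M.Q} {m k : ℕ} {s : S} (hs : s ≠ 0) :
    inNWA M N M (p, m, s) k ↔ confFar M N k (.inl (.inl (p, m))) := by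
  rw [confFar_iff]
  unfold inNWA kEquivU DWROCA.val
  simp only [run_left M N, uval_left M N, uval_right M N, Prod.forall, scaled_eq_iff hs]
  simp

lemma inNWA_right {q : N.Q} {n k : ℕ} {s : S} (hs : s ≠ 0) :
    inNWA M N N (q, n, s) k ↔ confFar M N k (.inl (.inr (q, n))) := by
  rw [confFar_iff]
  unfold inNWA kEquivU DWROCA.val
  simp only [run_right M N, uval_left M N, uval_right M N, Prod.forall, scaled_eq_iff hs]
  simp

lemma sInf_length_le_iff {p : List A → Prop} {n : ℕ} :
    sInf {k : ℕ∞ | ∃ w : List A, (w.length : ℕ∞) = k ∧ p w} ≤ n ↔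
      ∃ w : List A, w.length ≤ n ∧ p w := by
  constructor
  · intro h
    have hne : {k : ℕ∞ | ∃ w : List A, (w.length : ℕ∞) = k ∧ p w}.Nonempty := by
      by_contra hcon
      rw [Set.not_nonempty_iff_eq_empty.1 hcon, sInf_empty] at h
      exact ENat.natCast_ne_top n (top_le_iff.1 h)
    obtain ⟨w, hw, hp⟩ := csInf_mem hne
    rw [← hw] at h
    exact ⟨w, by exact_mod_cast h, hp⟩
  · rintro ⟨w, hw, hp⟩
    refine le_trans (sInf_le (a := (w.length : ℕ∞)) ⟨w, rfl, hp⟩) ?_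
    exact_mod_cast hw

lemma distNWA_left_le {p : M.Q} {m k n : ℕ} {s : S} (hs : s ≠ 0) :
    distNWA M N M (p, m, s) k ≤ n ↔
      Reach M (fun x => confFar M N k (.inl (.inl x))) n (p, m) := by
  unfold distNWA
  rw [sInf_length_le_iff]
  simp only [run_left M N, Reach]
  simp only [inNWA_left (mul_ne_zero hs (weight_ne_zero (confOut_ne_zero M N) _ _))]

lemma distNWA_right_le {q : N.Q} {m k n : ℕ} {s : S} (hs : s ≠ 0) :
    distNWA M N N (q, m, s) k ≤ n ↔
      Reach N (fun x => confFar M N k (.inl (.inr x))) n (q, m) := by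
  unfold distNWA
  rw [sInf_length_le_iff]
  simp only [run_right M N, Reach]
  simp only [inNWA_right (mul_ne_zero hs (weight_ne_zero (confOut_ne_zero M N) _ _))]

lemma le_of_forall_le_natCast {x y : ℕ∞} (h : ∀ n : ℕ, y ≤ n → x ≤ n) : x ≤ y := by
  induction y using ENat.recTopCoe with
  | top => exact le_top
  | coe k => exact h k le_rfl

lemma eq_iff_forall_le_natCast {x y : ℕ∞} : x = y ↔ ∀ n : ℕ, x ≤ n ↔ y ≤ n :=
  ⟨fun h n => by rw [h], fun h => le_antisymm (le_of_forall_le_natCast fun n => (h n).2)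
    (le_of_forall_le_natCast fun n => (h n).1)⟩

variable (M N) in
/-- The configurations of the left automaton far from the underlying weighted automata. -/
abbrev leftFar (K : ℕ) (x : M.Q × ℕ) : Prop := confFar M N K (.inl (.inl x))

variable (M N) in
/-- The configurations of the right automaton far from the underlying weighted automata. -/
abbrev rightFar (K : ℕ) (y : N.Q × ℕ) : Prop := confFar M N K (.inl (.inr y))

lemma leftFar.lt {K : ℕ} {x : M.Q × ℕ} (h : leftFar M N K x) : x.2 < K := by
  by_contra hcon
  exact (confFar_iff.1 h).1 x.1 fun v hv => confWeight_left_of_le M N x.1 x.2 v (by omega)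

lemma rightFar.lt {K : ℕ} {y : N.Q × ℕ} (h : rightFar M N K y) : y.2 < K := by
  by_contra hcon
  exact (confFar_iff.1 h).2 y.1 fun v hv => confWeight_right_of_le M N y.1 y.2 v (by omega)

lemma reach_left_iff {K n : ℕ} {x : M.Q × ℕ} : Reach M (leftFar M N K) n x ↔
    ∃ v : List A, v.length ≤ n ∧ confFar M N K (state (confStep M N) (.inl (.inl x)) v) := by
  simp only [state_left, Reach]

lemma reach_right_iff {K n : ℕ} {y : N.Q × ℕ} : Reach N (rightFar M N K) n y ↔
    ∃ v : List A, v.length ≤ n ∧ confFar M N K (state (confStep M N) (.inl (.inr y)) v) := by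
  simp only [state_right, Reach]

lemma reach_iff_of_confEqv {K n : ℕ} {x : M.Q × ℕ} {y : N.Q × ℕ}
    (h : confEqv M N (n + K) (.inl (.inl x)) (.inl (.inr y))) :
    Reach M (leftFar M N K) n x ↔ Reach N (rightFar M N K) n y := by
  rw [reach_left_iff, reach_right_iff]
  exact ⟨h.exists_farFrom (confOut_ne_zero M N), h.symm.exists_farFrom (confOut_ne_zero M N)⟩

lemma confEqv_of_not_reach {K e : ℕ} (hK : Fintype.card M.Q + Fintype.card N.Q = K)
    {x : M.Q × ℕ} {y : N.Q × ℕ}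
    (h : confEqv M N K (.inl (.inl x)) (.inl (.inr y)))
    (hx : ¬ Reach M (leftFar M N K) e x) (hy : ¬ Reach N (rightFar M N K) e y) :
    confEqv M N (K + e) (.inl (.inl x)) (.inl (.inr y)) := by
  rw [reach_left_iff] at hx
  rw [reach_right_iff] at hy
  have hpos : 0 < Fintype.card M.Q := Fintype.card_pos_iff.mpr ⟨x.1⟩
  exact h.extend (confOut_ne_zero M N) (confStep_mem_counterFree M N)
    (by rw [card_counterFree, hK]) (by omega) e
    (fun v hv hfar => hx ⟨v, hv, hfar⟩) (fun v hv hfar => hy ⟨v, hv, hfar⟩)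

lemma EqualDistRun.symm {TM : M.Q × ℕ → Prop} {TN : N.Q × ℕ → Prop}
    {K L j : ℕ} {x₀ : M.Q × ℕ} {y₀ : N.Q × ℕ} {w : List A}
    (E : EqualDistRun M N TM TN K L j x₀ y₀ w) : EqualDistRun N M TN TM K L j y₀ x₀ w where
  low_left := E.low_right
  low_right := E.low_left
  card_add := by rw [add_comm, E.card_add]
  init_left := E.init_right
  init_right := E.init_left
  le_length := E.le_length
  reach_iff i hi n := (E.reach_iff i hi n).symm
  finite i hi := by
    obtain ⟨n, hn⟩ := E.finite i hi
    exact ⟨n, (E.reach_iff i hi n).1 hn⟩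
  minimal u n h := (E.minimal u n h).symm

section Witness

variable {K j : ℕ} {x₀ : M.Q × ℕ} {y₀ : N.Q × ℕ} {w : List A}

lemma confEqv_of_length_lt
    (heq : ∀ v : List A, v.length < w.length →
      confWeight M N (.inl (.inl x₀)) v = confWeight M N (.inl (.inr y₀)) v)
    {u : List A} {k : ℕ} (h : u.length + k < w.length) :
    confEqv M N k (.inl (.inl (crun M x₀ u))) (.inl (.inr (crun N y₀ u))) := by
  have h1 : confEqv M N (u.length + k) (.inl (.inl x₀)) (.inl (.inr y₀)) :=
    fun v hv => heq v (by omega)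
  have h2 := h1.run (confOut_ne_zero M N)
  rwa [state_left, state_right] at h2

lemma lt_of_confEqv_take
    (heq : ∀ v : List A, v.length < w.length →
      confWeight M N (.inl (.inl x₀)) v = confWeight M N (.inl (.inr y₀)) v)
    (hne : confWeight M N (.inl (.inl x₀)) w ≠ confWeight M N (.inl (.inr y₀)) w)
    {i k : ℕ} (hi : i < w.length)
    (h : confEqv M N k (.inl (.inl (crun M x₀ (w.take i)))) (.inl (.inr (crun N y₀ (w.take i))))) :
    i + k < w.length := by
  by_contra hcon
  apply hne
  have h1 : confWeight M N (.inl (.inl x₀)) (w.take i ++ w.drop i) =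
      confWeight M N (.inl (.inr y₀)) (w.take i ++ w.drop i) := by
    rw [confWeight, weight_append, weight_append, state_left, state_right,
      h (w.drop i) (by rw [List.length_drop]; omega)]
    exact congrArg (· * _) (heq (w.take i) (by rw [List.length_take]; omega))
  rwa [List.take_append_drop] at h1

/-- Counter bound at the first pair of a minimal distinguishing run whose configurations are
inequivalent or have different distances to the far configurations. -/
theorem max_counter_le (hK : Fintype.card M.Q + Fintype.card N.Q = K)
    (hx₀ : x₀.2 = 0) (hy₀ : y₀.2 = 0)
    (heq : ∀ v : List A, v.length < w.length →
      confWeight M N (.inl (.inl x₀)) v = confWeight M N (.inl (.inr y₀)) v)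
    (hne : confWeight M N (.inl (.inl x₀)) w ≠ confWeight M N (.inl (.inr y₀)) w)
    (hj : j ≤ w.length)
    (hprev : ∀ i < j,
      confEqv M N K (.inl (.inl (crun M x₀ (w.take i)))) (.inl (.inr (crun N y₀ (w.take i)))) ∧
      ∀ n, Reach M (leftFar M N K) n (crun M x₀ (w.take i)) ↔
        Reach N (rightFar M N K) n (crun N y₀ (w.take i)))
    (hcur : j < w.length → confEqv M N K (.inl (.inl (crun M x₀ (w.take j))))
        (.inl (.inr (crun N y₀ (w.take j)))) →
      ∃ n, ¬ (Reach M (leftFar M N K) n (crun M x₀ (w.take j)) ↔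
        Reach N (rightFar M N K) n (crun N y₀ (w.take j)))) :
    max (crun M x₀ (w.take j)).2 (crun N y₀ (w.take j)).2 ≤ 14 * K ^ 6 + 6 * K ^ 7 + 1 := by
  classical
  by_contra! hbig
  have hKpos : 0 < Fintype.card M.Q := Fintype.card_pos_iff.mpr ⟨x₀.1⟩
  have hj0 : 0 < j := by
    rcases Nat.eq_zero_or_pos j with rfl | h
    · simp [hx₀, hy₀] at hbig
    · exact h
  have hjK : j + K ≤ w.length := by
    have := lt_of_confEqv_take heq hne (by omega) (hprev (j - 1) (by omega)).1
    omega
  have E : EqualDistRun M N (leftFar M N K) (rightFar M N K) K w.length j x₀ y₀ w :=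
    { low_left := fun _ h => h.lt
      low_right := fun _ h => h.lt
      card_add := hK
      init_left := hx₀
      init_right := hy₀
      le_length := hj
      reach_iff := fun i hi => (hprev i hi).2
      finite := by
        intro i hi
        by_contra! hcon
        have h := confEqv_of_not_reach hK (hprev i hi).1 (hcon w.length)
          (mt ((hprev i hi).2 _).2 (hcon w.length))
        have := lt_of_confEqv_take heq hne (by omega) h
        omega
      minimal := fun u n h => reach_iff_of_confEqv (confEqv_of_length_lt heq (by omega)) }
  have hEqv : confEqv M N K (.inl (.inl (crun M x₀ (w.take j))))
      (.inl (.inr (crun N y₀ (w.take j)))) := by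
    obtain ⟨u, hu, hM, hN, h1, h2, h3, h4⟩ := E.exists_copy hbig
    intro v hv
    have h5 := confEqv_of_length_lt heq (u := u) (k := K) (by omega) v hv
    have h6 := confWeight_left_of_le M N (crun M x₀ u).1 (crun M x₀ u).2 v (by omega)
    have h7 := confWeight_right_of_le M N (crun N y₀ u).1 (crun N y₀ u).2 v (by omega)
    have h8 := confWeight_left_of_le M N (crun M x₀ (w.take j)).1 _ v (hv.trans h3)
    have h9 := confWeight_right_of_le M N (crun N y₀ (w.take j)).1 _ v (hv.trans h4)
    exact h8.trans ((h6.trans (by rw [hM])).symm.trans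
      (h5.trans ((h7.trans (by rw [hN])).trans h9.symm)))
  have hex := hcur (by omega) hEqv
  set d := Nat.find hex with hd
  have hspec := Nat.find_spec hex
  rw [← hd] at hspec
  have hlen : j + K + d ≤ w.length := by
    rcases Nat.eq_zero_or_pos d with h0 | hpos
    · omega
    have hiff := not_not.1 (Nat.find_min hex (m := d - 1) (by omega))
    have hnr : ¬ Reach M (leftFar M N K) (d - 1) (crun M x₀ (w.take j)) := fun h =>
      hspec ⟨fun _ => (hiff.1 h).mono (by omega), fun _ => h.mono (by omega)⟩
    have := lt_of_confEqv_take heq hne (by omega)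
      (confEqv_of_not_reach hK hEqv hnr (mt hiff.2 hnr))
    omega
  exact hspec ⟨E.reach_right hbig hlen, E.symm.reach_right (by rwa [max_comm]) hlen⟩

end Witness

end Product

end CounterWalk

open CounterWalk

/-- the first surely-nonequivalent configuration pair `c_j` in
the run of a minimal witness satisfies
`max{m_{c_j}, n_{c_j}} ≤ 14K⁶ + K·(K²·6K⁴) + 1`. -/
theorem first_surely_nonequivalent_counter_bound {A S : Type} [Field S]
    (A₁ A₂ : DWROCA A S) (K : ℕ)
    (hK : K = Fintype.card A₁.Q + Fintype.card A₂.Q)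
    (w : List A) (hw : IsMinWitness A₁ A₂ w)
    (j : ℕ) (hj : j ≤ w.length)
    (hne : surelyNonEq A₁ A₂ (pairAt A₁ A₂ w j).1 (pairAt A₁ A₂ w j).2 K)
    (hfirst : ∀ i < j, ¬ surelyNonEq A₁ A₂ (pairAt A₁ A₂ w i).1 (pairAt A₁ A₂ w i).2 K) :
    max (pairAt A₁ A₂ w j).1.2.1 (pairAt A₁ A₂ w j).2.2.1 ≤
      14 * K ^ 6 + K * (K ^ 2 * (6 * K ^ 4)) + 1 := by
  obtain ⟨hdiff, hmin⟩ := hw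
  have hf₁ : ∀ v, A₁.f v = A₁.s0 * confWeight A₁ A₂ (.inl (.inl (A₁.q0, 0))) v := fun v => by
    unfold DWROCA.f DWROCA.val DWROCA.init
    rw [run_left A₁ A₂]
  have hf₂ : ∀ v, A₂.f v = A₂.s0 * confWeight A₁ A₂ (.inl (.inr (A₂.q0, 0))) v := fun v => by
    unfold DWROCA.f DWROCA.val DWROCA.init
    rw [run_right A₁ A₂]
  have hagree : ∀ v : List A, v.length < w.length → A₁.f v = A₂.f v := fun v hv => by
    by_contra hcon
    exact absurd (hmin v hcon) (by omega)
  have hs₁ : ∀ v, A₁.s0 * confWeight A₁ A₂ (.inl (.inl (A₁.q0, 0))) v ≠ 0 := fun v =>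
    mul_ne_zero A₁.s0_ne (weight_ne_zero (confOut_ne_zero A₁ A₂) _ _)
  have hs₂ : ∀ v, A₂.s0 * confWeight A₁ A₂ (.inl (.inr (A₂.q0, 0))) v ≠ 0 := fun v =>
    mul_ne_zero A₂.s0_ne (weight_ne_zero (confOut_ne_zero A₁ A₂) _ _)
  have hpair : ∀ i, surelyNonEq A₁ A₂ (pairAt A₁ A₂ w i).1 (pairAt A₁ A₂ w i).2 K ↔
      ¬ (A₁.f (w.take i) = A₂.f (w.take i) ∧
        confEqv A₁ A₂ K (.inl (.inl (crun A₁ (A₁.q0, 0) (w.take i))))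
          (.inl (.inr (crun A₂ (A₂.q0, 0) (w.take i)))) ∧
        ∀ n, Reach A₁ (leftFar A₁ A₂ K) n (crun A₁ (A₁.q0, 0) (w.take i)) ↔
          Reach A₂ (rightFar A₁ A₂ K) n (crun A₂ (A₂.q0, 0) (w.take i))) := by
    intro i
    unfold surelyNonEq pairAt DWROCA.init
    simp only [run_left A₁ A₂, run_right A₁ A₂]
    rw [kEquiv_iff (hs₁ _), Ne, eq_iff_forall_le_natCast, hf₁, hf₂]
    simp only [distNWA_left_le (hs₁ _), distNWA_right_le (hs₂ _)]
    tauto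
  have hcount : max (pairAt A₁ A₂ w j).1.2.1 (pairAt A₁ A₂ w j).2.2.1 =
      max (crun A₁ (A₁.q0, 0) (w.take j)).2 (crun A₂ (A₂.q0, 0) (w.take j)).2 := by
    unfold pairAt DWROCA.init
    simp only [run_left A₁ A₂, run_right A₁ A₂]
  rw [hcount]
  rcases Nat.eq_zero_or_pos j with rfl | hj0
  · simp
  have hs : A₁.s0 = A₂.s0 := by
    have := hagree [] (by simp; omega)
    simpa [hf₁, hf₂] using this
  refine (max_counter_le hK.symm rfl rfl (fun v hv => ?_) (fun h => hdiff ?_) hj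
    (fun i hi => (not_not.1 (mt (hpair i).2 (hfirst i hi))).2) fun hjw h => ?_).trans
    (le_of_eq (by ring))
  · have := hagree v hv
    rw [hf₁, hf₂, hs] at this
    exact mul_left_cancel₀ A₂.s0_ne this
  · rw [hf₁, hf₂, hs, h]
  · by_contra! hcon
    exact (hpair j).1 hne ⟨hagree _ (by rw [List.length_take]; omega), h, hcon⟩
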